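/- arXiv:1209.6206 — 9 statements merged into one kernel-verified Lean document; each statement's English description precedes it below -/
import Mathlib

section
/- Let Δ : ℝ → ℂ, ε ∈ ℂ, and ε̇ ∈ ℂ. Suppose (u,v) is a pair of differentiable functions satisfying the ZS equation with potential Δ and eigenvalue ε, and suppose (p,q) is a pair of differentiable functions ℝ → ℂ satisfying the derivative system −i·p'(x) + Δ(x)·q(x) = ε̇·u(x) + ε·p(x) and i·q'(x) + conj(Δ(x))·p(x) = ε̇·v(x) + ε·q(x) for all x. Then for all x ∈ ℝ: −i·d/dx[ p(x)·conj(u(x)) − q(x)·conj(v(x)) ] = ε̇·(|u(x)|² + |v(x)|²) + (ε − conj(ε))·( p(x)·conj(u(x)) + q(x)·conj(v(x)) ). In particular, if ε is real, then −i·d/dx[ p·conj(u) − q·conj(v) ] = ε̇·(|u|² + |v|²). -/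
/-- A pair of differentiable functions `u, v : ℝ → ℂ` satisfies the Zakharov–Shabat (ZS)
equation with potential `Δ : ℝ → ℂ` and eigenvalue `ε ∈ ℂ` if
`−i·u'(x) + Δ(x)·v(x) = ε·u(x)` and `i·v'(x) + conj(Δ(x))·u(x) = ε·v(x)` for all `x ∈ ℝ`. -/
def SatisfiesZS (Δ : ℝ → ℂ) (ε : ℂ) (u v : ℝ → ℂ) : Prop :=
  Differentiable ℝ u ∧ Differentiable ℝ v ∧
  (∀ x : ℝ, -Complex.I * deriv u x + Δ x * v x = ε * u x) ∧
  (∀ x : ℝ, Complex.I * deriv v x + (starRingEnd ℂ) (Δ x) * u x = ε * v x)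

/-- If `(u,v)` solves the ZS equation with eigenvalue `ε` and `(p,q)` solves the
corresponding derivative system with inhomogeneity `ε̇`, then
`−i·(p·conj u − q·conj v)' = ε̇·(|u|² + |v|²) + (ε − conj ε)·(p·conj u + q·conj v)`;
in particular, if `ε` is real, `−i·(p·conj u − q·conj v)' = ε̇·(|u|² + |v|²)`. -/
theorem zs_derivative_identity (Δ : ℝ → ℂ) (ε εdot : ℂ) (u v p q : ℝ → ℂ)
    (huv : SatisfiesZS Δ ε u v)
    (hp : Differentiable ℝ p) (hq : Differentiable ℝ q)
    (hp' : ∀ x : ℝ, -Complex.I * deriv p x + Δ x * q x = εdot * u x + ε * p x)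
    (hq' : ∀ x : ℝ, Complex.I * deriv q x + (starRingEnd ℂ) (Δ x) * p x
      = εdot * v x + ε * q x) :
    (∀ x : ℝ,
      -Complex.I * deriv (fun y => p y * (starRingEnd ℂ) (u y)
          - q y * (starRingEnd ℂ) (v y)) x
        = εdot * ((‖u x‖ : ℂ) ^ 2 + (‖v x‖ : ℂ) ^ 2)
          + (ε - (starRingEnd ℂ) ε)
            * (p x * (starRingEnd ℂ) (u x) + q x * (starRingEnd ℂ) (v x))) ∧
    (ε.im = 0 → ∀ x : ℝ,
      -Complex.I * deriv (fun y => p y * (starRingEnd ℂ) (u y)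
          - q y * (starRingEnd ℂ) (v y)) x
        = εdot * ((‖u x‖ : ℂ) ^ 2 + (‖v x‖ : ℂ) ^ 2)) := by
  obtain ⟨hu, hv, hu', hv'⟩ := huv
  have key : ∀ x : ℝ,
      -Complex.I * deriv (fun y => p y * (starRingEnd ℂ) (u y)
          - q y * (starRingEnd ℂ) (v y)) x
        = εdot * ((‖u x‖ : ℂ) ^ 2 + (‖v x‖ : ℂ) ^ 2)
          + (ε - (starRingEnd ℂ) ε)
            * (p x * (starRingEnd ℂ) (u x) + q x * (starRingEnd ℂ) (v x)) := by
    intro x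
    have hd : HasDerivAt (fun y => p y * (starRingEnd ℂ) (u y) - q y * (starRingEnd ℂ) (v y))
        ((deriv p x * (starRingEnd ℂ) (u x) + p x * (starRingEnd ℂ) (deriv u x))
          - (deriv q x * (starRingEnd ℂ) (v x) + q x * (starRingEnd ℂ) (deriv v x))) x :=
      ((hp x).hasDerivAt.mul (hu x).hasDerivAt.star).sub
        ((hq x).hasDerivAt.mul (hv x).hasDerivAt.star)
    have hcu := congrArg (starRingEnd ℂ) (hu' x)
    have hcv := congrArg (starRingEnd ℂ) (hv' x)
    simp only [map_add, map_mul, map_neg, Complex.conj_I, Complex.conj_conj] at hcu hcv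
    rw [hd.deriv, ← Complex.mul_conj', ← Complex.mul_conj']
    linear_combination (starRingEnd ℂ) (u x) * hp' x + (starRingEnd ℂ) (v x) * hq' x
      - p x * hcu - q x * hcv
  refine ⟨key, fun hε x => ?_⟩
  rw [key x, Complex.conj_eq_iff_im.mpr hε, sub_self, zero_mul, add_zero]
end

section
/- Let m > 0, j ≥ 1, let θ₁, …, θ_j ∈ (0, π) be pairwise distinct, and set s_l = exp(i·θ_l) and κ_l = m·sin(θ_l) for l = 1, …, j. Let e₁, …, e_j be positive real numbers. Define t = e_j · ∏_{l=1}^{j−1} (s_l − s_j)/(1 − s_l·s_j). Then t is a real number, and, defining for each l = 1, …, j the complex number f_l = (1/e_l) · [ ∏_{q=1}^{j−1} (s_q⁻¹ − s_l) / ∏_{p=1, p≠l}^{j} (s_p − s_l) ] · ( m·(s_j⁻¹ − s_l)/(2i) + κ_j²/(κ_j + t²) ), the following linear system is satisfied: for each r = 1, …, j−1, e_r − (2i/m)·Σ_{p=1}^{j} e_r·e_p·f_p/(s_r⁻¹ − s_p) = 0, and for the last row, f_j + e_j − (2i/m)·Σ_{p=1}^{j} e_j·e_p·f_p/(s_j⁻¹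 − s_p) = 0. -/
open Polynomial in
/-- The sum of `∏ (a q - v p) / ∏_{q ≠ p} (v q - v p)` over the nodes `p` is the coefficient
of degree `#S - 1` of a monic polynomial of degree `#T`. -/
theorem sum_prod_sub_div_prod_sub {F ι : Type*} [Field F] [DecidableEq ι] (S T : Finset ι)
    (v a : ι → F) (hv : Function.Injective v) (hT : T.card < S.card) :
    ∑ p ∈ S, (∏ q ∈ T, (a q - v p)) / ∏ q ∈ S.erase p, (v q - v p)
      = if T.card + 1 = S.card then 1 else 0 := by
  have hinj : Set.InjOn (-v) S := (neg_injective.comp hv).injOn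
  have hdeg : (Lagrange.nodal T (-a)).degree < S.card := by
    rw [Lagrange.degree_nodal]
    exact_mod_cast hT
  have key := Lagrange.coeff_eq_sum hinj hdeg
  simp only [Lagrange.eval_nodal, Pi.neg_apply, sub_neg_eq_add, neg_add_eq_sub] at key
  rw [← key]
  split_ifs with h
  · have hcard : S.card - 1 = (Lagrange.nodal T (-a)).natDegree := by
      rw [Lagrange.natDegree_nodal]
      omega
    rw [hcard]
    exact Lagrange.nodal_monic
  · apply coeff_eq_zero_of_natDegree_lt
    rw [Lagrange.natDegree_nodal]
    omega

open Polynomial in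
/-- Partial fraction decomposition of `∏ (a q - w) / ∏ (v q - w)`. -/
theorem sum_prod_sub_div_prod_sub_div_sub {F ι : Type*} [Field F] [DecidableEq ι]
    (S T : Finset ι) (v a : ι → F) (hv : Function.Injective v) (hT : T.card < S.card) (w : F)
    (hw : ∀ p, v p - w ≠ 0) :
    ∑ p ∈ S, (∏ q ∈ T, (a q - v p)) / (∏ q ∈ S.erase p, (v q - v p)) / (v p - w)
      = (∏ q ∈ T, (a q - w)) / ∏ q ∈ S, (v q - w) := by
  have hinj : Set.InjOn (-v) S := (neg_injective.comp hv).injOn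
  have hdeg : (Lagrange.nodal T (-a)).degree < S.card := by
    rw [Lagrange.degree_nodal]
    exact_mod_cast hT
  have key := congrArg (eval (-w)) (Lagrange.eq_interpolate hinj hdeg)
  rw [Lagrange.eval_interpolate_not_at_node _
    (fun i _ h => hw i (by rw [← neg_inj.mp h, sub_self]))] at key
  simp only [Lagrange.eval_nodal, Lagrange.nodalWeight, Pi.neg_apply, sub_neg_eq_add,
    neg_add_eq_sub] at key
  rw [key, mul_div_cancel_left₀ _ (Finset.prod_ne_zero_iff.mpr fun q _ => hw q)]
  refine Finset.sum_congr rfl fun p _ => ?_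
  rw [Finset.prod_inv_distrib]
  ring


/-- Explicit solution of the reduced GLM linear system near the `j`-th soliton:
with `s_l = exp(iθ_l)`, `κ_l = m sin θ_l`, positive `e_l`, and
`t = e_j ∏_{l=1}^{j−1} (s_l − s_j)/(1 − s_l s_j)`, the number `t` is real, and
`f_l = (1/e_l)·[∏_{q=1}^{j−1}(s_q⁻¹ − s_l) / ∏_{p≠l}(s_p − s_l)]
       ·(m(s_j⁻¹ − s_l)/(2i) + κ_j²/(κ_j + t²))`
solves the linear system: the first `j−1` rows `e_r − (2i/m)Σ_p e_r e_p f_p/(s_r⁻¹ − s_p) = 0`,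
and the last row `f_j + e_j − (2i/m)Σ_p e_j e_p f_p/(s_j⁻¹ − s_p) = 0`. -/
theorem reduced_glm_solution (m : ℝ) (hm : 0 < m) (j : ℕ) (hj : 1 ≤ j)
    (θ : Fin j → ℝ) (hθ : ∀ l, θ l ∈ Set.Ioo 0 Real.pi) (hθinj : Function.Injective θ)
    (e : Fin j → ℝ) (he : ∀ l, 0 < e l)
    (jl : Fin j) (hjl : (jl : ℕ) = j - 1)
    (s : Fin j → ℂ) (hs : ∀ l, s l = Complex.exp (Complex.I * (θ l : ℂ)))
    (κ : Fin j → ℝ) (hκ : ∀ l, κ l = m * Real.sin (θ l))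
    (t : ℂ)
    (ht : t = (e jl : ℂ) * ∏ l ∈ Finset.univ.erase jl, (s l - s jl) / (1 - s l * s jl))
    (f : Fin j → ℂ)
    (hf : ∀ l, f l = (1 / (e l : ℂ))
        * ((∏ q ∈ Finset.univ.erase jl, ((s q)⁻¹ - s l))
            / (∏ p ∈ Finset.univ.erase l, (s p - s l)))
        * ((m : ℂ) * ((s jl)⁻¹ - s l) / (2 * Complex.I)
            + ((κ jl : ℂ)) ^ 2 / ((κ jl : ℂ) + t ^ 2))) :
    t.im = 0 ∧
    (∀ r : Fin j, r ≠ jl →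
      (e r : ℂ) - (2 * Complex.I / (m : ℂ))
          * ∑ p : Fin j, (e r : ℂ) * (e p : ℂ) * f p / ((s r)⁻¹ - s p) = 0) ∧
    (f jl + (e jl : ℂ) - (2 * Complex.I / (m : ℂ))
        * ∑ p : Fin j, (e jl : ℂ) * (e p : ℂ) * f p / ((s jl)⁻¹ - s p) = 0) := by
  have hm' : (m : ℂ) ≠ 0 := by exact_mod_cast hm.ne'
  have he' : ∀ l, (e l : ℂ) ≠ 0 := fun l => by exact_mod_cast (he l).ne'
  have hsin : ∀ l, 0 < Real.sin (θ l) := fun l => Real.sin_pos_of_mem_Ioo (hθ l)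
  have hs1 : ∀ l, s l = Real.cos (θ l) + Real.sin (θ l) * Complex.I := fun l => by
    rw [hs, mul_comm, Complex.exp_mul_I, Complex.ofReal_cos, Complex.ofReal_sin]
  have hs2 : ∀ l, (s l)⁻¹ = Real.cos (θ l) - Real.sin (θ l) * Complex.I := fun l => by
    rw [hs, ← Complex.exp_neg, ← mul_neg, mul_comm, Complex.exp_mul_I, Complex.cos_neg,
      Complex.sin_neg, Complex.ofReal_cos, Complex.ofReal_sin]
    ring
  have hs0 : ∀ l, s l ≠ 0 := fun l => by rw [hs]; exact Complex.exp_ne_zero _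
  have hsinj : Function.Injective s := fun a b hab => by
    have h := congrArg Complex.re hab
    simp only [hs1, Complex.add_re, Complex.ofReal_re, Complex.re_ofReal_mul, Complex.I_re,
      mul_zero, add_zero] at h
    exact hθinj (Real.injOn_cos (Set.Ioo_subset_Icc_self (hθ a))
      (Set.Ioo_subset_Icc_self (hθ b)) h)
  have hden : ∀ r p, (s r)⁻¹ - s p ≠ 0 := fun r p h => by
    have h := congrArg Complex.im h
    rw [hs2, hs1] at h
    simp only [Complex.sub_im, Complex.add_im, Complex.ofReal_im,
      Complex.im_ofReal_mul, Complex.I_im, Complex.zero_im] at h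
    linarith [hsin r, hsin p]
  have hden' : ∀ r p, s p - (s r)⁻¹ ≠ 0 := fun r p => by
    rw [← neg_sub]
    exact neg_ne_zero.mpr (hden r p)
  have hone : ∀ l p, 1 - s l * s p ≠ 0 := fun l p h => hden l p (by
    have := hs0 l
    field_simp
    rw [h, mul_zero])
  have hconj : ∀ l, (starRingEnd ℂ) (s l) = (s l)⁻¹ := fun l => by
    rw [hs2, hs1]
    simp only [map_add, map_mul, Complex.conj_ofReal, Complex.conj_I]
    ring
  have htim : t.im = 0 := by
    rw [← Complex.conj_eq_iff_im, ht, map_mul, Complex.conj_ofReal, map_prod]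
    congr 1
    refine Finset.prod_congr rfl fun l _ => ?_
    simp only [map_div₀, map_sub, map_mul, map_one, hconj]
    have h1 := hs0 l
    have h2 := hs0 jl
    have h3 := hone l jl
    have h4 : 1 - (s l)⁻¹ * (s jl)⁻¹ ≠ 0 := fun h => h3 (by
      field_simp at h
      linear_combination -h)
    rw [div_eq_div_iff h4 h3]
    field_simp
    ring
  have hκ0 : (κ jl : ℂ) ≠ 0 := by
    rw [hκ]
    exact_mod_cast (mul_pos hm (hsin jl)).ne'
  have hκt : (κ jl : ℂ) + t ^ 2 ≠ 0 := by
    have htre : t = (t.re : ℂ) := Complex.ext rfl htim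
    have hpos : 0 < κ jl + t.re ^ 2 := by
      rw [hκ]
      have := mul_pos hm (hsin jl)
      positivity
    rw [htre]
    exact_mod_cast hpos.ne'
  set c : ℂ := (κ jl : ℂ) ^ 2 / ((κ jl : ℂ) + t ^ 2) with hc
  have hef : ∀ p, (e p : ℂ) * f p = (∏ q ∈ Finset.univ.erase jl, ((s q)⁻¹ - s p))
      / (∏ q ∈ Finset.univ.erase p, (s q - s p))
      * ((m : ℂ) * ((s jl)⁻¹ - s p) / (2 * Complex.I) + c) := fun p => by
    rw [hf p, ← mul_assoc, ← mul_assoc, mul_one_div_cancel (he' p), one_mul]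
  have hI := Complex.I_ne_zero
  have hcard : ∀ r : Fin j, (Finset.univ.erase r).card + 1 = (Finset.univ : Finset (Fin j)).card :=
    fun r => Finset.card_erase_add_one (Finset.mem_univ r)
  have hsum_one : ∀ r : Fin j, ∑ p, (∏ q ∈ Finset.univ.erase r, ((s q)⁻¹ - s p))
      / (∏ q ∈ Finset.univ.erase p, (s q - s p)) = 1 := fun r => by
    rw [sum_prod_sub_div_prod_sub Finset.univ (Finset.univ.erase r) s (fun q => (s q)⁻¹) hsinj
      (by have := hcard r; omega), if_pos (hcard r)]
  refine ⟨htim, fun r hr => ?_, ?_⟩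
  · set T := (Finset.univ.erase jl).erase r with hT
    have hrT : r ∈ Finset.univ.erase jl := Finset.mem_erase.mpr ⟨hr, Finset.mem_univ r⟩
    have hTcard : T.card + 1 = (Finset.univ.erase jl).card := Finset.card_erase_add_one hrT
    have hjT : jl ∈ Finset.univ.erase r := Finset.mem_erase.mpr ⟨hr.symm, Finset.mem_univ jl⟩
    have hT' : T = (Finset.univ.erase r).erase jl := Finset.erase_right_comm
    have hsum_zero : ∑ p, (∏ q ∈ T, ((s q)⁻¹ - s p))
        / (∏ q ∈ Finset.univ.erase p, (s q - s p)) = 0 := by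
      have := hcard jl
      rw [sum_prod_sub_div_prod_sub Finset.univ T s (fun q => (s q)⁻¹) hsinj (by omega),
        if_neg (by omega)]
    have hterm : ∀ p, (e r : ℂ) * (e p : ℂ) * f p / ((s r)⁻¹ - s p)
        = (e r : ℂ) * (m / (2 * Complex.I)) * ((∏ q ∈ Finset.univ.erase r, ((s q)⁻¹ - s p))
            / (∏ q ∈ Finset.univ.erase p, (s q - s p)))
          + (e r : ℂ) * c * ((∏ q ∈ T, ((s q)⁻¹ - s p))
            / (∏ q ∈ Finset.univ.erase p, (s q - s p))) := fun p => by
      rw [mul_assoc, hef p, ← Finset.mul_prod_erase _ (fun q => (s q)⁻¹ - s p) hrT,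
        ← Finset.mul_prod_erase _ (fun q => (s q)⁻¹ - s p) hjT, ← hT, ← hT',
        div_eq_iff (hden r p)]
      ring
    rw [Finset.sum_congr rfl fun p _ => hterm p, Finset.sum_add_distrib, ← Finset.mul_sum,
      ← Finset.mul_sum, hsum_one, hsum_zero]
    field_simp
    ring
  · have hpartial := sum_prod_sub_div_prod_sub_div_sub Finset.univ (Finset.univ.erase jl) s
      (fun q => (s q)⁻¹) hsinj (by have := hcard jl; omega) (s jl)⁻¹ (hden' jl)
    have hterm : ∀ p, (e jl : ℂ) * (e p : ℂ) * f p / ((s jl)⁻¹ - s p)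
        = (e jl : ℂ) * (m / (2 * Complex.I)) * ((∏ q ∈ Finset.univ.erase jl, ((s q)⁻¹ - s p))
            / (∏ q ∈ Finset.univ.erase p, (s q - s p)))
          - (e jl : ℂ) * c * ((∏ q ∈ Finset.univ.erase jl, ((s q)⁻¹ - s p))
            / (∏ q ∈ Finset.univ.erase p, (s q - s p)) / (s p - (s jl)⁻¹)) := fun p => by
      have hneg : s p - (s jl)⁻¹ = -((s jl)⁻¹ - s p) := (neg_sub _ _).symm
      rw [mul_assoc, hef p, hneg, div_eq_iff (hden jl p), div_neg, mul_neg, sub_neg_eq_add,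
        add_mul, mul_assoc _ (_ / ((s jl)⁻¹ - s p)), div_mul_cancel₀ _ (hden jl p)]
      ring
    have hdiff : s jl - (s jl)⁻¹ = 2 * Complex.I * (κ jl / m) := by
      rw [hs2, hs1, hκ]
      push_cast
      field_simp
      ring
    have hprod : (∏ q ∈ Finset.univ.erase jl, ((s q)⁻¹ - s jl))
          / (∏ q ∈ Finset.univ.erase jl, (s q - s jl)) * t ^ 2
        = (e jl : ℂ) ^ 2 * ((∏ q ∈ Finset.univ.erase jl, ((s q)⁻¹ - (s jl)⁻¹))
          / (∏ q ∈ Finset.univ.erase jl, (s q - (s jl)⁻¹))) := by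
      rw [ht, mul_pow, mul_left_comm, ← Finset.prod_pow, ← Finset.prod_div_distrib,
        ← Finset.prod_div_distrib, ← Finset.prod_mul_distrib]
      congr 1
      refine Finset.prod_congr rfl fun q hq => ?_
      have h1 := hs0 q
      have h2 := hs0 jl
      have h3 := hone q jl
      have h4 : s q - s jl ≠ 0 := sub_ne_zero.mpr (hsinj.ne (Finset.ne_of_mem_erase hq))
      have h5 := hden' jl q
      rw [eq_div_iff h5]
      field_simp
      ring
    rw [Finset.sum_congr rfl fun p _ => hterm p, Finset.sum_sub_distrib, ← Finset.mul_sum,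
      ← Finset.mul_sum, hsum_one, hpartial,
      ← Finset.mul_prod_erase _ (fun q => s q - (s jl)⁻¹) (Finset.mem_univ jl), hf jl,
      ← neg_sub (s jl), hdiff,
      div_mul_eq_div_div_swap (∏ q ∈ Finset.univ.erase jl, ((s q)⁻¹ - (s jl)⁻¹))]
    set B := (∏ q ∈ Finset.univ.erase jl, ((s q)⁻¹ - s jl))
      / (∏ q ∈ Finset.univ.erase jl, (s q - s jl))
    set R := (∏ q ∈ Finset.univ.erase jl, ((s q)⁻¹ - (s jl)⁻¹))
      / (∏ q ∈ Finset.univ.erase jl, (s q - (s jl)⁻¹))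
    have hej := he' jl
    clear_value B R
    rw [hc]
    field_simp
    linear_combination -(κ jl : ℂ) * hprod
end

section
/- In the n-soliton setup, for each j = 1, …, n the pair (u,v) with u(x) = f_j(x) and v(x) = s_j·conj(f_j(x)) satisfies the ZS equation with potential Δ and eigenvalue ε_j = m·cos(θ_j), i.e. −i·u'(x) + Δ(x)·v(x) = ε_j·u(x) and i·v'(x) + conj(Δ(x))·u(x) = ε_j·v(x) for all x ∈ ℝ. -/
open Matrix

/-- The differentiated linear system: if `(1 + G) f = -e` with `G' = K G + G K` and `e' = K e`
entrywise, then `(1 + G) f' + (K G + G K) f = -K e`. -/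
theorem row_deriv_of_mulVec_eq {n : ℕ} {κ : Fin n → ℝ} {e : Fin n → ℝ → ℝ}
    {G : ℝ → Matrix (Fin n) (Fin n) ℂ} {f : ℝ → Fin n → ℂ}
    (he : ∀ j x, HasDerivAt (fun y => (e j y : ℂ)) (κ j * e j x) x)
    (hG : ∀ i l x, HasDerivAt (fun y => G y i l) ((κ i + κ l) * G x i l) x)
    (hf : ∀ x i, f x i + ∑ l, G x i l * f x l = -(e i x : ℂ))
    (hfd : ∀ j, Differentiable ℝ (fun x => f x j)) (x : ℝ) (i : Fin n) :
    deriv (fun y => f y i) x + ∑ l, G x i l * deriv (fun y => f y l) x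
      + κ i * ∑ l, G x i l * f x l + ∑ l, G x i l * (κ l * f x l) = -(κ i * e i x : ℂ) := by
  have hd : HasDerivAt (fun y => f y i + ∑ l, G y i l * f y l)
      (deriv (fun y => f y i) x + ∑ l, ((κ i + κ l) * G x i l * f x l
        + G x i l * deriv (fun y => f y l) x)) x :=
    (hfd i x).hasDerivAt.add
      (HasDerivAt.fun_sum fun l _ => (hG i l x).mul (hfd l x).hasDerivAt)
  rw [funext fun y => hf y i] at hd
  rw [← hd.unique (he i x).neg, Finset.mul_sum]
  simp only [add_assoc, ← Finset.sum_add_distrib]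
  congr 1
  exact Finset.sum_congr rfl fun l _ => by ring

/-- The denominators `s_j⁻¹ - s_l` of the soliton matrix do not vanish, as `s_j⁻¹` lies in the
lower and `s_l` in the upper half plane. -/
theorem exp_I_mul_inv_sub_ne_zero {a b : ℝ} (ha : a ∈ Set.Ioo 0 Real.pi)
    (hb : b ∈ Set.Ioo 0 Real.pi) :
    (Complex.exp (Complex.I * a))⁻¹ - Complex.exp (Complex.I * b) ≠ 0 := by
  intro h
  have h := congrArg Complex.im h
  rw [← Complex.exp_neg] at h
  simp [Complex.exp_im] at h
  linarith [Real.sin_pos_of_mem_Ioo ha, Real.sin_pos_of_mem_Ioo hb]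

/-- In the `n`-soliton setup, for each `j` the bound state
`(u,v) = (f_j, s_j·conj f_j)` satisfies the ZS equation with potential `Δ` and
eigenvalue `ε_j = m cos θ_j`. -/
theorem nsoliton_bound_state_satisfies_zs
    (m : ℝ) (hm : 0 < m) (n : ℕ) (hn : 1 ≤ n)
    (θ xc : Fin n → ℝ) (hθ : ∀ j, θ j ∈ Set.Ioo 0 Real.pi)
    (hθinj : Function.Injective θ)
    (s : Fin n → ℂ) (hs : ∀ j, s j = Complex.exp (Complex.I * (θ j : ℂ)))
    (κ : Fin n → ℝ) (hκ : ∀ j, κ j = m * Real.sin (θ j))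
    (e : Fin n → ℝ → ℝ)
    (he : ∀ j x, e j x = Real.sqrt (κ j) * Real.exp (κ j * (x - xc j)))
    (G : ℝ → Matrix (Fin n) (Fin n) ℂ)
    (hG : ∀ x j l, G x j l
      = -(2 * Complex.I / (m : ℂ)) * (e j x : ℂ) * (e l x : ℂ) / ((s j)⁻¹ - s l))
    (hinv : ∀ x : ℝ, IsUnit (1 + G x))
    (f : ℝ → Fin n → ℂ)
    (hf : ∀ x : ℝ, (1 + G x) *ᵥ (f x) = fun j => -((e j x : ℂ)))
    (hfd : ∀ j, Differentiable ℝ (fun x => f x j))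
    (Δ : ℝ → ℂ)
    (hΔ : ∀ x : ℝ, Δ x = (m : ℂ) + 2 * Complex.I * ∑ j, (s j)⁻¹ * (e j x : ℂ) * f x j)
    (j : Fin n) :
    (∀ x : ℝ,
      -Complex.I * deriv (fun y => f y j) x
          + Δ x * (s j * (starRingEnd ℂ) (f x j))
        = ((m * Real.cos (θ j) : ℝ) : ℂ) * f x j) ∧
    (∀ x : ℝ,
      Complex.I * deriv (fun y => s j * (starRingEnd ℂ) (f y j)) x
          + (starRingEnd ℂ) (Δ x) * f x j
        = ((m * Real.cos (θ j) : ℝ) : ℂ) * (s j * (starRingEnd ℂ) (f x j))) := by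
  have hs0 : ∀ j, s j ≠ 0 := fun j => by rw [hs]; exact Complex.exp_ne_zero _
  have hsc : ∀ j, (starRingEnd ℂ) (s j) = (s j)⁻¹ := fun j => by
    rw [hs, ← Complex.exp_conj, ← Complex.exp_neg]; simp
  have hD : ∀ j l, (s j)⁻¹ - s l ≠ 0 := fun j l => by
    rw [hs, hs]; exact exp_I_mul_inv_sub_ne_zero (hθ j) (hθ l)
  have hm0 : (m : ℂ) ≠ 0 := by exact_mod_cast hm.ne'
  have hsv : ∀ j, s j = Real.cos (θ j) + Complex.I * Real.sin (θ j) := fun j => by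
    rw [hs, mul_comm, Complex.exp_mul_I]; push_cast; ring
  have hsi : ∀ j, (s j)⁻¹ = Real.cos (θ j) - Complex.I * Real.sin (θ j) := fun j => by
    rw [← hsc, hsv, map_add, map_mul, Complex.conj_ofReal, Complex.conj_ofReal, Complex.conj_I]
    ring
  have hκ' : ∀ j, (κ j : ℂ) = m * Real.sin (θ j) := fun j => by rw [hκ]; push_cast; ring
  have hed : ∀ j x, HasDerivAt (fun y => (e j y : ℂ)) (κ j * e j x) x := fun j x => by
    have h : HasDerivAt (e j) (κ j * e j x) x := by
      have := (((hasDerivAt_id x).sub_const (xc j)).const_mul (κ j)).exp.const_mul (√(κ j))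
      rw [funext (he j)]
      exact this.congr_deriv (by simp only [id]; ring)
    simpa using h.ofReal_comp
  have hGd : ∀ i l x, HasDerivAt (fun y => G y i l) ((κ i + κ l) * G x i l) x := fun i l x => by
    have h := (((hed i x).const_mul (-(2 * Complex.I / (m : ℂ)))).mul (hed l x)).div_const
      ((s i)⁻¹ - s l)
    rw [funext fun y => hG y i l, hG]
    exact h.congr_deriv (by ring)
  have hrow : ∀ x i, f x i + ∑ l, G x i l * f x l = -(e i x : ℂ) := fun x i => by
    have h := congrFun (hf x) i
    rwa [Matrix.add_mulVec, Matrix.one_mulVec] at h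
  have hGc : ∀ x i l, s i * (starRingEnd ℂ) (G x i l) = G x i l * s l := fun x i l => by
    have h : s i - (s l)⁻¹ ≠ 0 := by
      intro h; exact hD l i (by linear_combination -h)
    have h' : s i * ((s i)⁻¹ - s l) = -(s l * (s i - (s l)⁻¹)) := by
      field_simp [hs0 i, hs0 l]; ring
    simp only [hG, map_div₀, map_mul, map_neg, map_sub, map_inv₀, Complex.conj_ofReal,
      Complex.conj_I, hsc, inv_inv, map_ofNat]
    rw [mul_div_assoc', div_mul_eq_mul_div, div_eq_div_iff h (hD i l)]
    linear_combination (2 * Complex.I / (m : ℂ)) * (e i x : ℂ) * (e l x : ℂ) * h'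
  have hconj : ∀ x i, s i * (starRingEnd ℂ) (f x i)
      + ∑ l, G x i l * (s l * (starRingEnd ℂ) (f x l)) = -(s i * e i x : ℂ) := fun x i => by
    have h := congrArg (fun z => s i * (starRingEnd ℂ) z) (hrow x i)
    simp only [map_add, map_sum, map_mul, map_neg, Complex.conj_ofReal, mul_add,
      Finset.mul_sum] at h
    rw [← mul_neg, ← h]
    congr 1
    exact Finset.sum_congr rfl fun l _ => by rw [← mul_assoc, ← hGc]; ring
  have hGs : ∀ x i l, m * (G x i l * (s l)⁻¹)
      = m * s i * G x i l - 2 * Complex.I * s i * e i x * ((s l)⁻¹ * e l x) := fun x i l => by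
    have h : G x i l * ((s i)⁻¹ - s l) = -(2 * Complex.I / (m : ℂ)) * e i x * e l x := by
      rw [hG, div_mul_cancel₀ _ (hD i l)]
    have h' : m * (G x i l * ((s i)⁻¹ - s l)) = -(2 * Complex.I) * e i x * e l x := by
      rw [h]; field_simp
    linear_combination (s i * (s l)⁻¹) * h'
      - m * G x i l * (s l)⁻¹ * mul_inv_cancel₀ (hs0 i)
      + m * G x i l * s i * mul_inv_cancel₀ (hs0 l)
  have hsum : ∀ x i, ∑ l, G x i l * (m * Real.cos (θ l) * f x l)
      - Complex.I * ∑ l, G x i l * (κ l * f x l)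
      = m * s i * ∑ l, G x i l * f x l - s i * e i x * (Δ x - m) := fun x i => by
    have hΔ' : Δ x - m = 2 * Complex.I * ∑ j, (s j)⁻¹ * (e j x : ℂ) * f x j := by
      rw [hΔ]; ring
    rw [hΔ']
    simp only [Finset.mul_sum, ← Finset.sum_sub_distrib]
    refine Finset.sum_congr rfl fun l _ => ?_
    linear_combination f x l * hGs x i l - m * G x i l * f x l * hsi l
      - Complex.I * G x i l * f x l * hκ' l
  have hzs : ∀ x j, -Complex.I * deriv (fun y => f y j) x
      + Δ x * (s j * (starRingEnd ℂ) (f x j)) = m * Real.cos (θ j) * f x j := fun x j => by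
    have hw : (1 + G x) *ᵥ (fun j => -Complex.I * deriv (fun y => f y j) x
        + Δ x * (s j * (starRingEnd ℂ) (f x j)) - m * Real.cos (θ j) * f x j)
        = (1 + G x) *ᵥ 0 := by
      ext i
      have hsplit : ∑ l, G x i l * (-Complex.I * deriv (fun y => f y l) x
          + Δ x * (s l * (starRingEnd ℂ) (f x l)) - m * Real.cos (θ l) * f x l)
          = -Complex.I * ∑ l, G x i l * deriv (fun y => f y l) x
            + Δ x * ∑ l, G x i l * (s l * (starRingEnd ℂ) (f x l))
            - ∑ l, G x i l * (m * Real.cos (θ l) * f x l) := by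
        simp only [Finset.mul_sum, ← Finset.sum_add_distrib, ← Finset.sum_sub_distrib]
        exact Finset.sum_congr rfl fun l _ => by ring
      rw [Matrix.mulVec_zero, Matrix.add_mulVec, Matrix.one_mulVec, Pi.add_apply, Pi.zero_apply]
      simp only [Matrix.mulVec, dotProduct]
      rw [hsplit]
      linear_combination -Complex.I * row_deriv_of_mulVec_eq hed hGd hrow hfd x i
        + Δ x * hconj x i - hsum x i - m * s i * hrow x i
        + (m * f x i) * hsv i
        + Complex.I * (e i x + ∑ l, G x i l * f x l) * hκ' i
        + Complex.I * m * Real.sin (θ i) * hrow x i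
    have h := congrFun (Matrix.mulVec_injective_of_isUnit (hinv x) hw) j
    simpa [sub_eq_zero] using h
  refine ⟨fun x => by rw [hzs]; push_cast; ring, fun x => ?_⟩
  have hd : deriv (fun y => s j * (starRingEnd ℂ) (f y j)) x
      = s j * (starRingEnd ℂ) (deriv (fun y => f y j) x) :=
    ((hfd j x).hasDerivAt.star.const_mul (s j)).deriv
  have h := congrArg (starRingEnd ℂ) (hzs x j)
  simp only [map_add, map_mul, map_neg, Complex.conj_I, Complex.conj_ofReal, hsc,
    Complex.conj_conj] at h
  rw [hd]
  push_cast at h ⊢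
  linear_combination s j * h
    - (starRingEnd ℂ) (Δ x) * f x j * mul_inv_cancel₀ (hs0 j)
end

section
/- In the n-soliton setup, for each j = 1, …, n the bound state (u_j, v_j) = (f_j, s_j·conj(f_j)) is normalized: the function x ↦ |f_j(x)|² is integrable on ℝ and ∫_ℝ ( |u_j(x)|² + |v_j(x)|² ) dx = 2·∫_ℝ |f_j(x)|² dx = 1. -/
open Matrix MeasureTheory

open Filter Topology in
/-- A function with nonnegative continuous derivative and finite limits at `±∞` has an integrable
derivative. -/
lemma integrable_of_hasDerivAt_of_nonneg_of_tendsto {F F' : ℝ → ℝ} {a b : ℝ}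
    (hF : ∀ x, HasDerivAt F (F' x) x) (hcont : Continuous F') (hpos : ∀ x, 0 ≤ F' x)
    (hbot : Tendsto F atBot (𝓝 a)) (htop : Tendsto F atTop (𝓝 b)) : Integrable F' := by
  refine integrable_of_intervalIntegral_norm_tendsto (b - a) (a := fun x : ℝ => -x) (b := id)
    (l := atTop) (fun x => (hcont.integrableOn_Icc).mono_set Set.Ioc_subset_Icc_self)
    tendsto_neg_atTop_atBot tendsto_id ?_
  have h : ∀ x : ℝ, ∫ t in (-x)..(id x), ‖F' t‖ = F x - F (-x) := by
    intro x
    simp_rw [Real.norm_of_nonneg (hpos _)]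
    exact intervalIntegral.integral_eq_sub_of_hasDerivAt (fun t _ => hF t)
      (hcont.intervalIntegrable _ _)
  simp_rw [h]
  exact htop.sub (hbot.comp tendsto_neg_atTop_atBot)

/-- A Cauchy matrix with distinct nodes is nonsingular. -/
lemma Matrix.det_cauchy_ne_zero {ι K : Type*} [Fintype ι] [DecidableEq ι] [Field K] {a b : ι → K}
    (ha : Function.Injective a) (hb : Function.Injective b) (hab : ∀ i j, a i ≠ b j) :
    (Matrix.of fun i j => (a i - b j)⁻¹).det ≠ 0 := by
  intro hdet
  obtain ⟨c, hc0, hc⟩ := Matrix.exists_mulVec_eq_zero_iff.mpr hdet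
  let P : Polynomial K :=
    ∑ l, Polynomial.C (c l) * ∏ k ∈ Finset.univ.erase l, (Polynomial.X - Polynomial.C (b k))
  have hdeg : P.degree < (Finset.univ : Finset ι).card := by
    refine (Polynomial.degree_sum_le _ _).trans_lt ?_
    rw [Finset.sup_lt_iff (WithBot.bot_lt_coe _)]
    intro l _
    refine (Polynomial.degree_mul_le _ _).trans_lt ?_
    refine (add_le_add Polynomial.degree_C_le le_rfl).trans_lt ?_
    rw [Polynomial.degree_prod, zero_add]
    simp only [Polynomial.degree_X_sub_C, Finset.sum_const, nsmul_eq_mul, mul_one]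
    exact_mod_cast Finset.card_erase_lt_of_mem (Finset.mem_univ l)
  have hroot : ∀ i ∈ Finset.univ, P.eval (a i) = 0 := by
    intro i _
    have hi := congrFun hc i
    simp only [Matrix.mulVec, dotProduct, Matrix.of_apply, Pi.zero_apply] at hi
    have hP : P.eval (a i) = (∏ k, (a i - b k)) * ∑ l, (a i - b l)⁻¹ * c l := by
      simp only [P, Polynomial.eval_finsetSum, Polynomial.eval_mul, Polynomial.eval_C,
        Polynomial.eval_prod, Polynomial.eval_sub, Polynomial.eval_X, Finset.mul_sum]
      refine Finset.sum_congr rfl fun l _ => ?_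
      rw [← Finset.mul_prod_erase _ _ (Finset.mem_univ l)]
      have := sub_ne_zero.mpr (hab i l)
      field_simp
    rw [hP, hi, mul_zero]
  have hP0 : P = 0 :=
    Polynomial.eq_zero_of_degree_lt_of_eval_index_eq_zero _ ha.injOn hdeg hroot
  refine hc0 (funext fun l => ?_)
  have hl : P.eval (b l) = c l * ∏ k ∈ Finset.univ.erase l, (b l - b k) := by
    simp only [P, Polynomial.eval_finsetSum, Polynomial.eval_mul, Polynomial.eval_C,
      Polynomial.eval_prod, Polynomial.eval_sub, Polynomial.eval_X]
    refine Finset.sum_eq_single l (fun k _ hkl => ?_) (by simp)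
    rw [Finset.prod_eq_zero (Finset.mem_erase.mpr ⟨hkl.symm, Finset.mem_univ l⟩) (sub_self _),
      mul_zero]
  rw [hP0, Polynomial.eval_zero] at hl
  refine (mul_eq_zero.mp hl.symm).resolve_right (Finset.prod_ne_zero_iff.mpr fun k hk => ?_)
  exact sub_ne_zero.mpr (hb.ne (Finset.ne_of_mem_erase hk).symm)

lemma Matrix.differentiableAt_det {ι : Type*} [Fintype ι] [DecidableEq ι]
    {A : ℝ → Matrix ι ι ℂ} {x : ℝ} (hA : ∀ i j, DifferentiableAt ℝ (fun y => A y i j) x) :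
    DifferentiableAt ℝ (fun y => (A y).det) x := by
  simp only [Matrix.det_apply']
  fun_prop

lemma Matrix.differentiableAt_inv {ι : Type*} [Fintype ι] [DecidableEq ι]
    {A : ℝ → Matrix ι ι ℂ} {x : ℝ} (hx : IsUnit (A x))
    (hA : ∀ i j, DifferentiableAt ℝ (fun y => A y i j) x) (i j : ι) :
    DifferentiableAt ℝ (fun y => (A y)⁻¹ i j) x := by
  simp only [Matrix.inv_def, Ring.inverse_eq_inv', Matrix.smul_apply, smul_eq_mul,
    Matrix.adjugate_apply]
  refine ((differentiableAt_det hA).inv ((Matrix.isUnit_iff_isUnit_det _).mp hx).ne_zero).mul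
    (differentiableAt_det fun k l => ?_)
  simp only [Matrix.updateRow_apply]
  split_ifs
  · exact differentiableAt_const _
  · exact hA k l

/-- The derivative of the inverse of an invertible matrix, entrywise. -/
lemma Matrix.hasDerivAt_inv {ι : Type*} [Fintype ι] [DecidableEq ι]
    {A : ℝ → Matrix ι ι ℂ} {A' : Matrix ι ι ℂ} {x : ℝ} (hu : ∀ y, IsUnit (A y))
    (hA : ∀ i j, HasDerivAt (fun y => A y i j) (A' i j) x) (i j : ι) :
    HasDerivAt (fun y => (A y)⁻¹ i j) (-((A x)⁻¹ * A' * (A x)⁻¹) i j) x := by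
  have hd := fun i j =>
    (differentiableAt_inv (hu x) (fun i j => (hA i j).differentiableAt) i j).hasDerivAt
  set D : Matrix ι ι ℂ := Matrix.of fun i j => deriv (fun y => (A y)⁻¹ i j) x with hD
  have hdet := (Matrix.isUnit_iff_isUnit_det _).mp (hu x)
  have h : A' * (A x)⁻¹ + A x * D = 0 := by
    ext k l
    have h1 : HasDerivAt (fun y => ∑ p, A y k p * (A y)⁻¹ p l)
        (∑ p, (A' k p * (A x)⁻¹ p l + A x k p * D p l)) x :=
      HasDerivAt.fun_sum fun p _ => (hA k p).mul (hd p l)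
    have h2 : (fun y => ∑ p, A y k p * (A y)⁻¹ p l) = fun _ => (1 : Matrix ι ι ℂ) k l := by
      ext y
      rw [← Matrix.mul_apply, Matrix.mul_nonsing_inv _ ((Matrix.isUnit_iff_isUnit_det _).mp (hu y))]
    rw [h2] at h1
    simpa [Matrix.mul_apply, Finset.sum_add_distrib] using h1.unique (hasDerivAt_const x _)
  have hDeq : D = -((A x)⁻¹ * A' * (A x)⁻¹) := by
    rw [← Matrix.nonsing_inv_mul_cancel_left (A x) D hdet, eq_neg_of_add_eq_zero_right h,
      Matrix.mul_neg, Matrix.mul_assoc]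
  have := hd i j
  rwa [show deriv (fun y => (A y)⁻¹ i j) x = D i j from rfl, hDeq] at this

open Filter Topology in
lemma Matrix.tendsto_inv {ι α : Type*} [Fintype ι] [DecidableEq ι] {l : Filter α}
    {A : α → Matrix ι ι ℂ} {B : Matrix ι ι ℂ} (hA : Tendsto A l (𝓝 B)) (hB : B.det ≠ 0) :
    Tendsto (fun x => (A x)⁻¹) l (𝓝 B⁻¹) := by
  simp only [Matrix.inv_def, Ring.inverse_eq_inv']
  exact ((((continuous_id.matrix_det).tendsto B).comp hA).inv₀ hB).smul
    (((continuous_id.matrix_adjugate).tendsto B).comp hA)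

/-- In the `n`-soliton setup, each bound state `(u_j, v_j) = (f_j, s_j·conj f_j)` is
normalized: `x ↦ |f_j(x)|²` is integrable and
`∫ (|u_j|² + |v_j|²) = 2∫ |f_j|² = 1`. -/
theorem nsoliton_bound_state_normalized
    (m : ℝ) (hm : 0 < m) (n : ℕ) (hn : 1 ≤ n)
    (θ xc : Fin n → ℝ) (hθ : ∀ j, θ j ∈ Set.Ioo 0 Real.pi)
    (hθinj : Function.Injective θ)
    (s : Fin n → ℂ) (hs : ∀ j, s j = Complex.exp (Complex.I * (θ j : ℂ)))
    (κ : Fin n → ℝ) (hκ : ∀ j, κ j = m * Real.sin (θ j))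
    (e : Fin n → ℝ → ℝ)
    (he : ∀ j x, e j x = Real.sqrt (κ j) * Real.exp (κ j * (x - xc j)))
    (G : ℝ → Matrix (Fin n) (Fin n) ℂ)
    (hG : ∀ x j l, G x j l
      = -(2 * Complex.I / (m : ℂ)) * (e j x : ℂ) * (e l x : ℂ) / ((s j)⁻¹ - s l))
    (hinv : ∀ x : ℝ, IsUnit (1 + G x))
    (f : ℝ → Fin n → ℂ)
    (hf : ∀ x : ℝ, (1 + G x) *ᵥ (f x) = fun j => -((e j x : ℂ)))
    (hfd : ∀ j, Differentiable ℝ (fun x => f x j))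
    (Δ : ℝ → ℂ)
    (hΔ : ∀ x : ℝ, Δ x = (m : ℂ) + 2 * Complex.I * ∑ j, (s j)⁻¹ * (e j x : ℂ) * f x j)
    (j : Fin n) :
    Integrable (fun x : ℝ => ‖f x j‖ ^ 2) ∧
    (∫ x : ℝ, (‖f x j‖ ^ 2 + ‖s j * (starRingEnd ℂ) (f x j)‖ ^ 2)) = 1 ∧
    2 * (∫ x : ℝ, ‖f x j‖ ^ 2) = 1 := by
  have hκpos : ∀ j, 0 < κ j := fun j => by
    rw [hκ]; exact mul_pos hm (Real.sin_pos_of_mem_Ioo (hθ j))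
  have hepos : ∀ j x, 0 < e j x := fun j x => by
    rw [he]; exact mul_pos (Real.sqrt_pos.mpr (hκpos j)) (Real.exp_pos _)
  have hs0 : ∀ j, s j ≠ 0 := fun j => by rw [hs]; exact Complex.exp_ne_zero _
  have hsform : ∀ j, s j = ⟨Real.cos (θ j), Real.sin (θ j)⟩ := fun j => by
    rw [hs, mul_comm, Complex.exp_mul_I, ← Complex.ofReal_cos, ← Complex.ofReal_sin]
    apply Complex.ext <;>
      simp [-Complex.ofReal_cos, -Complex.ofReal_sin]
  have hsconj : ∀ j, (starRingEnd ℂ) (s j) = (s j)⁻¹ := fun j => by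
    rw [hs, ← Complex.exp_conj, ← Complex.exp_neg]; simp
  have hsnorm : ∀ j, ‖s j‖ = 1 := fun j => by
    rw [hs, mul_comm, Complex.norm_exp_ofReal_mul_I]
  have hsinj : Function.Injective s := fun a b hab => by
    have h := congrArg Complex.re hab
    rw [hsform, hsform] at h
    exact hθinj (Real.injOn_cos (Set.Ioo_subset_Icc_self (hθ a))
      (Set.Ioo_subset_Icc_self (hθ b)) h)
  have hne : ∀ a b, (s a)⁻¹ ≠ s b := fun a b hab => by
    rw [← hsconj] at hab
    have h := congrArg Complex.im hab
    rw [hsform, hsform] at h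
    simp only [Complex.conj_im] at h
    have ha := Real.sin_pos_of_mem_Ioo (hθ a)
    have hb := Real.sin_pos_of_mem_Ioo (hθ b)
    linarith
  have hmC : (m : ℂ) ≠ 0 := by exact_mod_cast hm.ne'
  have hκs : ∀ j, (κ j : ℂ) = m * (s j - (s j)⁻¹) / (2 * Complex.I) := fun j => by
    rw [← hsconj, hκ, hsform, Complex.sub_conj]
    push_cast
    field_simp
  have hed : ∀ j x, HasDerivAt (fun y => (e j y : ℂ)) (κ j * e j x : ℂ) x := fun j x => by
    have h : HasDerivAt (e j) (κ j * e j x) x := by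
      have h1 := ((((hasDerivAt_id x).sub_const (xc j)).const_mul (κ j)).exp).const_mul
        (Real.sqrt (κ j))
      rw [funext (he j)]
      exact h1.congr_deriv (by simp only [id]; ring)
    exact_mod_cast h.ofReal_comp
  have hetop : ∀ j, Filter.Tendsto (e j) Filter.atTop Filter.atTop := fun j => by
    rw [funext (he j)]
    exact (Real.tendsto_exp_atTop.comp ((Filter.tendsto_id.atTop_add
      (tendsto_const_nhds (x := -xc j))).const_mul_atTop (hκpos j))).const_mul_atTop
        (Real.sqrt_pos.mpr (hκpos j))
  have hebot : ∀ j, Filter.Tendsto (fun x => (e j x : ℂ)) Filter.atBot (nhds 0) := fun j => by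
    have h : Filter.Tendsto (e j) Filter.atBot (nhds 0) := by
      rw [funext (he j), ← mul_zero (Real.sqrt (κ j))]
      exact (Real.tendsto_exp_atBot.comp ((Filter.tendsto_id.atBot_add
        (tendsto_const_nhds (x := -xc j))).const_mul_atBot (hκpos j))).const_mul _
    exact_mod_cast (Complex.continuous_ofReal.tendsto 0).comp h
  have hH : ∀ x, IsUnit (1 + G x).det := fun x => (Matrix.isUnit_iff_isUnit_det _).mp (hinv x)
  -- `1 + G` is Hermitian, and its transpose is its conjugate by the diagonal matrix of the `s j`.
  have hherm : ∀ x, ((1 + G x)⁻¹)ᴴ = (1 + G x)⁻¹ := fun x => by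
    rw [Matrix.conjTranspose_nonsing_inv, Matrix.conjTranspose_add, Matrix.conjTranspose_one]
    congr 2
    ext a b
    have h2 : s b - (s a)⁻¹ ≠ 0 := sub_ne_zero.mpr (hne a b).symm
    rw [Matrix.conjTranspose_apply, hG, hG]
    simp only [Complex.star_def, map_mul, map_div₀, map_neg, map_sub, map_inv₀, hsconj, Complex.conj_I,
      Complex.conj_ofReal, map_ofNat, inv_inv]
    rw [← neg_sub (s b), div_neg]
    field_simp
  have hdiag : ∀ x, Matrix.diagonal s * (1 + G x)ᵀ = (1 + G x) * Matrix.diagonal s := fun x => by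
    rw [Matrix.transpose_add, Matrix.transpose_one, mul_add, add_mul, mul_one, one_mul]
    congr 1
    ext a b
    have h1 := sub_ne_zero.mpr (hne a b)
    rw [Matrix.diagonal_mul, Matrix.mul_diagonal, Matrix.transpose_apply, hG, hG]
    have := hs0 a
    have := hs0 b
    have h3 : 1 - s a * s b ≠ 0 := fun h => h1 (by field_simp; linear_combination h)
    rw [show (s a)⁻¹ - s b = (1 - s a * s b) / s a by field_simp,
      show (s b)⁻¹ - s a = (1 - s a * s b) / s b by field_simp]
    field_simp
  have hsym : ∀ x a b, (1 + G x)⁻¹ a b * s b = s a * (1 + G x)⁻¹ b a := fun x a b => by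
    have h : (1 + G x)⁻¹ * Matrix.diagonal s = Matrix.diagonal s * ((1 + G x)⁻¹)ᵀ := by
      have hT : IsUnit ((1 + G x)ᵀ).det := by rw [Matrix.det_transpose]; exact hH x
      calc (1 + G x)⁻¹ * Matrix.diagonal s
          = (1 + G x)⁻¹ * (Matrix.diagonal s * (1 + G x)ᵀ) * ((1 + G x)ᵀ)⁻¹ := by
            rw [Matrix.mul_assoc, Matrix.mul_assoc, Matrix.mul_nonsing_inv _ hT, Matrix.mul_one]
        _ = Matrix.diagonal s * ((1 + G x)⁻¹)ᵀ := by
            rw [hdiag, ← Matrix.mul_assoc, Matrix.nonsing_inv_mul _ (hH x), Matrix.one_mul,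
              Matrix.transpose_nonsing_inv]
    simpa [Matrix.mul_diagonal, Matrix.diagonal_mul] using congrFun (congrFun h a) b
  have hrow : ∀ x, ∑ k, (1 + G x)⁻¹ j k * e k x = -f x j := fun x => by
    have h : (1 + G x)⁻¹ *ᵥ (fun k => -((e k x : ℂ))) = f x := by
      rw [← hf x, Matrix.mulVec_mulVec, Matrix.nonsing_inv_mul _ (hH x), Matrix.one_mulVec]
    rw [← h]
    simp [Matrix.mulVec, dotProduct]
  have hcol : ∀ x, ∑ k, e k x * (1 + G x)⁻¹ k j = -(starRingEnd ℂ) (f x j) := fun x => by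
    rw [← map_neg, ← hrow, map_sum]
    refine Finset.sum_congr rfl fun k _ => ?_
    conv_lhs => rw [← hherm x]
    rw [Matrix.conjTranspose_apply, map_mul, Complex.conj_ofReal, mul_comm]
    rfl
  have hGd : ∀ x a b, HasDerivAt (fun y => (1 + G y) a b)
      ((e a x : ℂ) * e b x * (1 + s a * (s b)⁻¹)) x := fun x a b => by
    simp only [Matrix.add_apply, hG]
    have h := (((((hed a x).const_mul (-(2 * Complex.I / (m : ℂ)))).mul (hed b x)).div_const
      ((s a)⁻¹ - s b))).const_add ((1 : Matrix (Fin n) (Fin n) ℂ) a b)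
    refine h.congr_deriv ?_
    have h1 := sub_ne_zero.mpr (hne a b)
    rw [hκs, hκs, div_eq_iff h1]
    have := hs0 a
    have := hs0 b
    field_simp
    ring
  have hFd : ∀ x, HasDerivAt (fun y => -((1 + G y)⁻¹ j j)) (2 * (‖f x j‖ ^ 2 : ℝ) : ℂ) x :=
      fun x => by
    refine ((Matrix.hasDerivAt_inv (A' := Matrix.of fun a b =>
      (e a x : ℂ) * e b x * (1 + s a * (s b)⁻¹)) hinv (hGd x) j j).neg).congr_deriv ?_
    have h1 : ∑ k, (1 + G x)⁻¹ j k * s k * e k x = -(s j * (starRingEnd ℂ) (f x j)) := by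
      rw [← mul_neg, ← hcol, Finset.mul_sum]
      exact Finset.sum_congr rfl fun k _ => by rw [hsym]; ring
    have h2 : ∑ k, (s k)⁻¹ * e k x * (1 + G x)⁻¹ k j = -((s j)⁻¹ * f x j) := by
      rw [← mul_neg, ← hrow, Finset.mul_sum]
      refine Finset.sum_congr rfl fun k _ => ?_
      have := hsym x k j
      have := hs0 k
      have := hs0 j
      field_simp
      grind
    have h3 : ((1 + G x)⁻¹ * (Matrix.of fun a b => (e a x : ℂ) * e b x * (1 + s a * (s b)⁻¹))
        * (1 + G x)⁻¹) j j
        = (∑ k, (1 + G x)⁻¹ j k * e k x) * (∑ k, e k x * (1 + G x)⁻¹ k j)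
        + (∑ k, (1 + G x)⁻¹ j k * s k * e k x) * (∑ k, (s k)⁻¹ * e k x * (1 + G x)⁻¹ k j) := by
      simp only [Matrix.mul_apply, Matrix.of_apply, Finset.sum_mul, Finset.mul_sum]
      rw [← Finset.sum_add_distrib]
      refine Finset.sum_congr rfl fun a _ => ?_
      rw [← Finset.sum_add_distrib]
      exact Finset.sum_congr rfl fun b _ => by ring
    rw [neg_neg, h3, hrow, hcol, h1, h2]
    have := hs0 j
    have hn := Complex.mul_conj' (f x j)
    push_cast
    rw [← hn]
    field_simp
    ring
  have hF : ∀ x, HasDerivAt (fun y => -((1 + G y)⁻¹ j j).re) (2 * ‖f x j‖ ^ 2) x := fun x => by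
    have h := Complex.reCLM.hasFDerivAt.comp_hasDerivAt x (hFd x)
    refine (h.congr_deriv ?_)
    simp only [Complex.reCLM_apply]
    exact_mod_cast Complex.ofReal_re (2 * ‖f x j‖ ^ (2 : ℕ))
  have hbot : Filter.Tendsto (fun y => -((1 + G y)⁻¹ j j).re) Filter.atBot (nhds (-1)) := by
    have hlim : Filter.Tendsto (fun y => 1 + G y) Filter.atBot (nhds 1) := by
      refine tendsto_pi_nhds.mpr fun a => tendsto_pi_nhds.mpr fun b => ?_
      simp only [Matrix.add_apply, hG]
      have h := ((((hebot a).const_mul (-(2 * Complex.I / (m : ℂ)))).mul (hebot b)).div_const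
        ((s a)⁻¹ - s b)).const_add ((1 : Matrix (Fin n) (Fin n) ℂ) a b)
      simpa using h
    have h := Matrix.tendsto_inv hlim (by simp)
    have h' := (tendsto_pi_nhds.mp (tendsto_pi_nhds.mp h j) j)
    simpa using ((Complex.continuous_re.tendsto _).comp h').neg
  have htop : Filter.Tendsto (fun y => -((1 + G y)⁻¹ j j).re) Filter.atTop (nhds 0) := by
    have hinv0 : ∀ k, Filter.Tendsto (fun x => ((e k x : ℂ))⁻¹) Filter.atTop (nhds 0) := fun k => by
      exact_mod_cast (Complex.continuous_ofReal.tendsto 0).comp (hetop k).inv_tendsto_atTop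
    set C : Matrix (Fin n) (Fin n) ℂ :=
      (-(2 * Complex.I / (m : ℂ))) • Matrix.of fun a b => ((s a)⁻¹ - s b)⁻¹ with hC
    have hCdet : C.det ≠ 0 := by
      rw [hC, Matrix.det_smul]
      refine mul_ne_zero (pow_ne_zero _ (by simp [hmC])) ?_
      exact Matrix.det_cauchy_ne_zero (inv_injective.comp hsinj) hsinj hne
    have hlim : Filter.Tendsto (fun x => Matrix.diagonal (fun k => ((e k x : ℂ))⁻¹ ^ 2) + C) Filter.atTop
        (nhds C) := by
      refine tendsto_pi_nhds.mpr fun a => tendsto_pi_nhds.mpr fun b => ?_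
      simp only [Matrix.add_apply, Matrix.diagonal_apply]
      by_cases hab : a = b
      · simpa [hab] using ((hinv0 a).pow 2).add_const (C a b)
      · simp [hab]
    have hfac : ∀ x, (1 + G x)⁻¹ j j = ((e j x : ℂ))⁻¹ *
        (Matrix.diagonal (fun k => ((e k x : ℂ))⁻¹ ^ 2) + C)⁻¹ j j * ((e j x : ℂ))⁻¹ := fun x => by
      have he0 : ∀ k, (e k x : ℂ) ≠ 0 := fun k => by exact_mod_cast (hepos k x).ne'
      have h : 1 + G x = Matrix.diagonal (fun k => (e k x : ℂ)) *
          (Matrix.diagonal (fun k => ((e k x : ℂ))⁻¹ ^ 2) + C) *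
          Matrix.diagonal (fun k => (e k x : ℂ)) := by
        ext a b
        rw [Matrix.mul_diagonal, Matrix.diagonal_mul, Matrix.add_apply, Matrix.add_apply, hG]
        have ha := he0 a
        by_cases hab : a = b
        · subst hab
          simp only [hC, Matrix.one_apply_eq, Matrix.diagonal_apply_eq, Matrix.smul_apply,
            Matrix.of_apply, smul_eq_mul]
          field_simp
        · simp only [hC, Matrix.one_apply_ne hab, Matrix.diagonal_apply_ne _ hab,
            Matrix.smul_apply, Matrix.of_apply, smul_eq_mul]
          ring
      have hdinv : (Matrix.diagonal (fun k => (e k x : ℂ)))⁻¹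
          = Matrix.diagonal (fun k => ((e k x : ℂ))⁻¹) := by
        refine Matrix.inv_eq_right_inv ?_
        rw [Matrix.diagonal_mul_diagonal, ← Matrix.diagonal_one]
        exact congrArg _ (funext fun k => mul_inv_cancel₀ (he0 k))
      rw [h, Matrix.mul_inv_rev, Matrix.mul_inv_rev, hdinv, Matrix.diagonal_mul,
        Matrix.mul_diagonal, mul_assoc]
    have h := tendsto_pi_nhds.mp (tendsto_pi_nhds.mp (Matrix.tendsto_inv hlim hCdet) j) j
    have h' := ((hinv0 j).mul h).mul (hinv0 j)
    simp only [mul_zero] at h'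
    simp only [hfac]
    simpa using ((Complex.continuous_re.tendsto _).comp h').neg
  have hcont : Continuous fun x => 2 * ‖f x j‖ ^ 2 := by
    have := (hfd j).continuous
    fun_prop
  have hint := integrable_of_hasDerivAt_of_nonneg_of_tendsto hF hcont (fun x => by positivity)
    hbot htop
  have hval : 2 * (∫ x : ℝ, ‖f x j‖ ^ 2) = 1 := by
    rw [← integral_const_mul, integral_of_hasDerivAt_of_tendsto hF hint hbot htop]
    norm_num
  refine ⟨by simpa [mul_comm] using hint.const_mul (1 / 2 : ℝ), ?_, hval⟩
  rw [← hval, ← integral_const_mul]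
  refine integral_congr_ae (Filter.Eventually.of_forall fun x => ?_)
  simp only [norm_mul, hsnorm, RCLike.norm_conj]
  ring
end

section
/- In the n-soliton setup, for every real s ≠ 0 the pair (u(·,s), v(·,s)) defined by u(x,s) = exp(i·k(s)·x)·[ 1 + (2i/m)·Σ_{j=1}^{n} e_j(x)·f_j(x)/(s_j − s) ] and v(x,s) = exp(i·k(s)·x)·[ s⁻¹ + (2i/m)·Σ_{j=1}^{n} e_j(x)·s_j·conj(f_j(x))/(s_j − s) ], where k(s) = (m/2)(s − s⁻¹), satisfies the ZS equation with potential Δ and eigenvalue ε(s) = (m/2)(s + s⁻¹): −i·∂ₓu(x,s) + Δ(x)·v(x,s) = ε(s)·u(x,s) and i·∂ₓv(x,s) + conj(Δ(x))·u(x,s) = ε(s)·v(x,s) for all x ∈ ℝ. (The denominators s_j − s are nonzero since s is real and each s_j is non-real.) -/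
open Matrix

open Complex ComplexConjugate

section Algebra

variable {ι : Type*} [Fintype ι]

/-- The defect of the first ZS equation, as a function of the spectral parameter `z`, is the
partial fraction whose coefficients are its residues at the points `S j`. -/
lemma zs_defect_eq_partial_fraction {M z D : ℂ} (hM : M ≠ 0) (hz : z ≠ 0) {A F H S : ι → ℂ}
    (P : ι → ℂ) (hS : ∀ j, S j ≠ 0) (hSz : ∀ j, S j - z ≠ 0)
    (hD : D = M + 2 * I * ∑ j, (S j)⁻¹ * A j * F j) :
    -I * (2 * I / M * ∑ j, A j * P j / (S j - z))
        + D * (z⁻¹ + 2 * I / M * ∑ j, A j * S j * H j / (S j - z))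
        - M * z⁻¹ * (1 + 2 * I / M * ∑ j, A j * F j / (S j - z))
      = 2 * I / M * ∑ j,
          A j * (-I * P j + D * S j * H j - M * (S j)⁻¹ * F j) / (S j - z) := by
  have key : z⁻¹ * (∑ j, (S j)⁻¹ * A j * F j) - z⁻¹ * ∑ j, A j * F j / (S j - z)
      = - ∑ j, (S j)⁻¹ * A j * F j / (S j - z) := by
    rw [Finset.mul_sum, Finset.mul_sum, ← Finset.sum_sub_distrib, ← Finset.sum_neg_distrib]
    refine Finset.sum_congr rfl fun j _ => ?_
    have h1 := hS j
    have h2 := hSz j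
    field_simp
    ring
  have split : ∑ j, A j * (-I * P j + D * S j * H j - M * (S j)⁻¹ * F j) / (S j - z)
      = -I * (∑ j, A j * P j / (S j - z)) + D * (∑ j, A j * S j * H j / (S j - z))
        - M * ∑ j, (S j)⁻¹ * A j * F j / (S j - z) := by
    simp only [Finset.mul_sum, ← Finset.sum_add_distrib, ← Finset.sum_sub_distrib]
    exact Finset.sum_congr rfl fun j _ => by ring
  have hc : M * (2 * I / M) = 2 * I := by field_simp
  rw [split]
  linear_combination z⁻¹ * hD + 2 * I * key
    - (z⁻¹ * (∑ j, A j * F j / (S j - z)) - ∑ j, (S j)⁻¹ * A j * F j / (S j - z)) * hc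

/-- The bound state equations: if `F` solves the soliton linear system and `F'` solves its
derivative, then the residues of the defect of the first ZS equation vanish. -/
lemma zs_bound_state_residue_eq_zero [DecidableEq ι] {M D : ℂ} (hM : M ≠ 0) (hMc : conj M = M)
    {A F F' S K : ι → ℂ} (hAc : ∀ j, conj (A j) = A j)
    (hS : ∀ j, S j ≠ 0) (hSc : ∀ j, conj (S j) = (S j)⁻¹)
    (hSS : ∀ j l, (S j)⁻¹ - S l ≠ 0) (hK : ∀ j, M * (S j - (S j)⁻¹) = 2 * I * K j)
    {G : Matrix ι ι ℂ} (hG : ∀ j l, G j l = -(2 * I / M) * A j * A l / ((S j)⁻¹ - S l))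
    (hinv : IsUnit (1 + G))
    (hF : ∀ j, F j = -A j * (1 + 2 * I / M * ∑ l, A l * F l / (S l - (S j)⁻¹)))
    (hF' : ∀ j, F' j = K j * F j
      - A j * (2 * I / M * ∑ l, A l * (K l * F l + F' l) / (S l - (S j)⁻¹)))
    (hD : D = M + 2 * I * ∑ j, (S j)⁻¹ * A j * F j) (j : ι) :
    -I * (K j * F j + F' j) + D * S j * conj (F j) - M * (S j)⁻¹ * F j = 0 := by
  have hSS' : ∀ j l, S l - (S j)⁻¹ ≠ 0 := fun j l h => hSS j l (by linear_combination -h)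
  set r : ι → ℂ := fun j =>
    -I * (K j * F j + F' j) + D * S j * conj (F j) - M * (S j)⁻¹ * F j with hr
  have hV : ∀ j, A j * ((S j)⁻¹⁻¹
      + 2 * I / M * ∑ l, A l * S l * conj (F l) / (S l - (S j)⁻¹)) = -S j * conj (F j) := by
    intro j
    have hconj := congrArg conj (hF j)
    simp only [map_mul, map_neg, map_add, map_sum, map_div₀, map_sub, map_one, map_inv₀, hAc, hSc,
      hMc, conj_I, inv_inv, map_ofNat] at hconj
    have hsum : ∑ l, A l * S l * conj (F l) / (S l - (S j)⁻¹)
        = -S j * ∑ l, A l * conj (F l) / ((S l)⁻¹ - S j) := by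
      rw [Finset.mul_sum]
      refine Finset.sum_congr rfl fun l _ => ?_
      have h1 := hSS l j
      have h2 := hSS' j l
      have h3 := hS l
      have h4 := hS j
      rw [← mul_div_assoc, div_eq_div_iff h2 h1]
      field_simp
      ring
    rw [hsum, inv_inv]
    linear_combination S j * hconj
  have hrj : ∀ j, r j = -A j * (2 * I / M * ∑ l, A l * r l / (S l - (S j)⁻¹)) := by
    intro j
    have h := zs_defect_eq_partial_fraction (H := fun l => conj (F l)) hM (inv_ne_zero (hS j))
      (fun l => K l * F l + F' l) hS (hSS' j) hD
    simp only [hr]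
    rw [← h]
    have hVj := hV j
    rw [inv_inv] at hVj ⊢
    linear_combination -I * hF' j + D * hVj - M * S j * hF j + F j * hK j
  have hker : (1 + G) *ᵥ r = 0 := by
    funext j
    rw [Matrix.add_mulVec, Matrix.one_mulVec, Pi.add_apply, Pi.zero_apply, hrj j]
    simp only [Matrix.mulVec, dotProduct, Finset.mul_sum]
    rw [← Finset.sum_add_distrib]
    refine Finset.sum_eq_zero fun l _ => ?_
    have h1 := hSS j l
    have h2 := hSS' j l
    have h3 : S l - (S j)⁻¹ = -((S j)⁻¹ - S l) := by ring
    rw [hG, h3, div_neg]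
    ring
  exact congrFun (Matrix.mulVec_injective_of_isUnit hinv (hker.trans (Matrix.mulVec_zero _).symm)) j

end Algebra

/-- In the `n`-soliton setup, for every real `s ≠ 0` the scattering state
`u(x,s) = e^{ik(s)x}[1 + (2i/m)Σ_j e_j f_j/(s_j − s)]`,
`v(x,s) = e^{ik(s)x}[s⁻¹ + (2i/m)Σ_j e_j s_j conj(f_j)/(s_j − s)]`,
with `k(s) = (m/2)(s − s⁻¹)`, satisfies the ZS equation with potential `Δ` and
eigenvalue `ε(s) = (m/2)(s + s⁻¹)`. -/
theorem nsoliton_scattering_state_satisfies_zs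
    (m : ℝ) (hm : 0 < m) (n : ℕ) (hn : 1 ≤ n)
    (θ xc : Fin n → ℝ) (hθ : ∀ j, θ j ∈ Set.Ioo 0 Real.pi)
    (hθinj : Function.Injective θ)
    (s : Fin n → ℂ) (hs : ∀ j, s j = Complex.exp (Complex.I * (θ j : ℂ)))
    (κ : Fin n → ℝ) (hκ : ∀ j, κ j = m * Real.sin (θ j))
    (e : Fin n → ℝ → ℝ)
    (he : ∀ j x, e j x = Real.sqrt (κ j) * Real.exp (κ j * (x - xc j)))
    (G : ℝ → Matrix (Fin n) (Fin n) ℂ)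
    (hG : ∀ x j l, G x j l
      = -(2 * Complex.I / (m : ℂ)) * (e j x : ℂ) * (e l x : ℂ) / ((s j)⁻¹ - s l))
    (hinv : ∀ x : ℝ, IsUnit (1 + G x))
    (f : ℝ → Fin n → ℂ)
    (hf : ∀ x : ℝ, (1 + G x) *ᵥ (f x) = fun j => -((e j x : ℂ)))
    (hfd : ∀ j, Differentiable ℝ (fun x => f x j))
    (Δ : ℝ → ℂ)
    (hΔ : ∀ x : ℝ, Δ x = (m : ℂ) + 2 * Complex.I * ∑ j, (s j)⁻¹ * (e j x : ℂ) * f x j)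
    (sr : ℝ) (hsr : sr ≠ 0) (u v : ℝ → ℂ)
    (hu : ∀ x : ℝ, u x = Complex.exp (Complex.I * ((m / 2 * (sr - sr⁻¹) : ℝ) : ℂ) * x)
      * (1 + (2 * Complex.I / (m : ℂ))
          * ∑ j, (e j x : ℂ) * f x j / (s j - (sr : ℂ))))
    (hv : ∀ x : ℝ, v x = Complex.exp (Complex.I * ((m / 2 * (sr - sr⁻¹) : ℝ) : ℂ) * x)
      * (((sr : ℂ))⁻¹ + (2 * Complex.I / (m : ℂ))
          * ∑ j, (e j x : ℂ) * s j * (starRingEnd ℂ) (f x j) / (s j - (sr : ℂ)))) :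
    (∀ x : ℝ, -Complex.I * deriv u x + Δ x * v x
        = ((m / 2 * (sr + sr⁻¹) : ℝ) : ℂ) * u x) ∧
    (∀ x : ℝ, Complex.I * deriv v x + (starRingEnd ℂ) (Δ x) * u x
        = ((m / 2 * (sr + sr⁻¹) : ℝ) : ℂ) * v x) := by
  have hM : (m : ℂ) ≠ 0 := by exact_mod_cast hm.ne'
  have hsin : ∀ j, 0 < Real.sin (θ j) := fun j => Real.sin_pos_of_mem_Ioo (hθ j)
  have hs' : ∀ j, s j = Complex.cos (θ j) + Complex.sin (θ j) * I := by
    intro j; rw [hs, mul_comm, Complex.exp_mul_I]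
  have hS : ∀ j, s j ≠ 0 := fun j => by rw [hs]; exact Complex.exp_ne_zero _
  have hSinv : ∀ j, (s j)⁻¹ = Complex.cos (θ j) - Complex.sin (θ j) * I := by
    intro j
    rw [hs, ← Complex.exp_neg, show -(I * (θ j : ℂ)) = (-(θ j : ℂ)) * I by ring,
      Complex.exp_mul_I, Complex.cos_neg, Complex.sin_neg]
    ring
  have him : ∀ j, (s j).im = Real.sin (θ j) := by
    intro j; simp [hs', Complex.sin_ofReal_re]
  have hSc : ∀ j, conj (s j) = (s j)⁻¹ := by
    intro j
    rw [hSinv, hs']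
    simp [sub_eq_add_neg, ← Complex.cos_conj, ← Complex.sin_conj]
  have himinv : ∀ j, ((s j)⁻¹).im = -Real.sin (θ j) := by
    intro j; rw [← hSc, Complex.conj_im, him]
  have hSS : ∀ j l, (s j)⁻¹ - s l ≠ 0 := by
    intro j l h
    have := congrArg Complex.im h
    rw [Complex.sub_im, himinv, him, Complex.zero_im] at this
    linarith [hsin j, hsin l]
  have hSr : ∀ (t : ℝ) j, s j - (t : ℂ) ≠ 0 := by
    intro t j h
    have := congrArg Complex.im h
    rw [Complex.sub_im, him, Complex.zero_im, Complex.ofReal_im] at this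
    linarith [hsin j]
  have hK : ∀ j, (m : ℂ) * (s j - (s j)⁻¹) = 2 * I * (κ j : ℂ) := by
    intro j
    rw [hSinv, hs', hκ]
    push_cast
    ring
  have hed : ∀ j x, HasDerivAt (fun y => (e j y : ℂ)) ((κ j : ℂ) * e j x) x := by
    intro j x
    have h1 : HasDerivAt (e j) (κ j * e j x) x := by
      have h2 : HasDerivAt (fun y => κ j * (y - xc j)) (κ j) x := by
        simpa using ((hasDerivAt_id x).sub_const (xc j)).const_mul (κ j)
      have h3 := h2.exp.const_mul (Real.sqrt (κ j))
      rw [show e j = fun y => Real.sqrt (κ j) * Real.exp (κ j * (y - xc j)) from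
        funext fun y => he j y]
      exact h3.congr_deriv (by ring)
    simpa using h1.ofReal_comp
  set f' : ℝ → Fin n → ℂ := fun x j => deriv (fun y => f y j) x
  have hfd' : ∀ j x, HasDerivAt (fun y => f y j) (f' x j) x := fun j x => (hfd j x).hasDerivAt
  have hsumd : ∀ (z : ℂ) x, HasDerivAt (fun y => 1 + 2 * I / (m : ℂ)
      * ∑ l, (e l y : ℂ) * f y l / (s l - z))
      (2 * I / (m : ℂ) * ∑ l, (e l x : ℂ) * ((κ l : ℂ) * f x l + f' x l) / (s l - z)) x := by
    intro z x
    refine HasDerivAt.const_add _ (HasDerivAt.const_mul _ ?_)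
    refine HasDerivAt.fun_sum fun l _ => ?_
    exact (((hed l x).mul (hfd' l x)).div_const (s l - z)).congr_deriv (by ring)
  have hF : ∀ x j, f x j = -(e j x : ℂ)
      * (1 + 2 * I / (m : ℂ) * ∑ l, (e l x : ℂ) * f x l / (s l - (s j)⁻¹)) := by
    intro x j
    have h := congrFun (hf x) j
    rw [Matrix.add_mulVec, Matrix.one_mulVec, Pi.add_apply] at h
    have h1 : (G x *ᵥ f x) j = (e j x : ℂ)
        * (2 * I / (m : ℂ) * ∑ l, (e l x : ℂ) * f x l / (s l - (s j)⁻¹)) := by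
      simp only [Matrix.mulVec, dotProduct, Finset.mul_sum]
      refine Finset.sum_congr rfl fun l _ => ?_
      rw [hG, show s l - (s j)⁻¹ = -((s j)⁻¹ - s l) by ring, div_neg]
      ring
    linear_combination h - h1
  have hF' : ∀ x j, f' x j = (κ j : ℂ) * f x j - (e j x : ℂ) * (2 * I / (m : ℂ)
      * ∑ l, (e l x : ℂ) * ((κ l : ℂ) * f x l + f' x l) / (s l - (s j)⁻¹)) := by
    intro x j
    have h1 := (hed j x).neg.mul (hsumd (s j)⁻¹ x)
    have h2 := hfd' j x
    rw [show (fun y => f y j) = _ from funext fun y => hF y j] at h2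
    have h3 := h2.unique h1
    rw [h3]
    simp only [Pi.neg_apply]
    linear_combination -(κ j : ℂ) * hF x j
  have hfirst : ∀ (t : ℝ), t ≠ 0 → ∀ x : ℝ,
      -I * (2 * I / (m : ℂ) * ∑ l, (e l x : ℂ) * ((κ l : ℂ) * f x l + f' x l) / (s l - (t : ℂ)))
        + Δ x * ((t : ℂ)⁻¹ + 2 * I / (m : ℂ)
          * ∑ l, (e l x : ℂ) * s l * conj (f x l) / (s l - (t : ℂ)))
        - m * (t : ℂ)⁻¹ * (1 + 2 * I / (m : ℂ) * ∑ l, (e l x : ℂ) * f x l / (s l - (t : ℂ)))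
        = 0 := by
    intro t ht x
    rw [zs_defect_eq_partial_fraction (H := fun l => conj (f x l)) hM (by exact_mod_cast ht)
      (fun l => (κ l : ℂ) * f x l + f' x l) hS (hSr t) (hΔ x)]
    rw [Finset.sum_eq_zero, mul_zero]
    intro l _
    rw [zs_bound_state_residue_eq_zero hM (Complex.conj_ofReal m) (fun j => Complex.conj_ofReal _) hS hSc hSS hK (hG x) (hinv x) (hF x) (hF' x) (hΔ x) l]
    simp
  have hsr' : (sr : ℂ) ≠ 0 := by exact_mod_cast hsr
  have hsymm : ∀ g : Fin n → ℂ, (∑ l, g l / ((s l)⁻¹ - (sr : ℂ)⁻¹))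
      = -(sr : ℂ) * ∑ l, g l * s l / (s l - (sr : ℂ)) := by
    intro g
    rw [Finset.mul_sum]
    refine Finset.sum_congr rfl fun l _ => ?_
    have h1 := hSr sr l
    have h2 := hS l
    have h3 : (s l)⁻¹ - (sr : ℂ)⁻¹ ≠ 0 := by
      rw [inv_sub_inv h2 hsr']
      exact div_ne_zero (by rw [← neg_sub]; exact neg_ne_zero.2 h1) (mul_ne_zero h2 hsr')
    rw [← mul_div_assoc, div_eq_div_iff h3 h1]
    field_simp
    ring
  have hsecond : ∀ x : ℝ,
      I * (2 * I / (m : ℂ) * ∑ l, (e l x : ℂ) * s l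
          * ((κ l : ℂ) * conj (f x l) + conj (f' x l)) / (s l - (sr : ℂ)))
        + conj (Δ x) * (1 + 2 * I / (m : ℂ) * ∑ l, (e l x : ℂ) * f x l / (s l - (sr : ℂ)))
        - m * (sr : ℂ) * ((sr : ℂ)⁻¹ + 2 * I / (m : ℂ)
          * ∑ l, (e l x : ℂ) * s l * conj (f x l) / (s l - (sr : ℂ))) = 0 := by
    intro x
    have h := congrArg conj (hfirst sr⁻¹ (inv_ne_zero hsr) x)
    simp only [map_mul, map_neg, map_add, map_sum, map_div₀, map_sub, map_one, map_inv₀, map_zero,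
      hSc, Complex.conj_ofReal, Complex.ofReal_inv, conj_I, inv_inv, map_ofNat, Complex.conj_conj,
      hsymm] at h
    have h1 : ∀ g : Fin n → ℂ, ∑ l, (e l x : ℂ) * g l * s l / (s l - (sr : ℂ))
        = ∑ l, (e l x : ℂ) * s l * g l / (s l - (sr : ℂ)) :=
      fun g => Finset.sum_congr rfl fun l _ => by ring
    have h2 : ∑ l, (e l x : ℂ) * (s l)⁻¹ * f x l * s l / (s l - (sr : ℂ))
        = ∑ l, (e l x : ℂ) * f x l / (s l - (sr : ℂ)) := by
      refine Finset.sum_congr rfl fun l _ => ?_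
      congr 1
      field_simp [hS l]
    rw [h1, h1, h2] at h
    refine (mul_eq_zero.1 (?_ : (sr : ℂ) * _ = 0)).resolve_left hsr'
    have h3 : (sr : ℂ) * (sr : ℂ)⁻¹ = 1 := mul_inv_cancel₀ hsr'
    linear_combination h - (m : ℂ) * sr * h3
  have hVd : ∀ x, HasDerivAt (fun y => (sr : ℂ)⁻¹ + 2 * I / (m : ℂ)
      * ∑ l, (e l y : ℂ) * s l * conj (f y l) / (s l - (sr : ℂ)))
      (2 * I / (m : ℂ) * ∑ l, (e l x : ℂ) * s l
          * ((κ l : ℂ) * conj (f x l) + conj (f' x l)) / (s l - (sr : ℂ))) x := by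
    intro x
    refine HasDerivAt.const_add _ (HasDerivAt.const_mul _ ?_)
    refine HasDerivAt.fun_sum fun l _ => ?_
    have h1 : HasDerivAt (fun y => conj (f y l)) (conj (f' x l)) x := (hfd' l x).star
    exact ((((hed l x).mul_const (s l)).mul h1).div_const (s l - (sr : ℂ))).congr_deriv (by ring)
  have hexp : ∀ x : ℝ, HasDerivAt
      (fun y : ℝ => Complex.exp (I * ((m / 2 * (sr - sr⁻¹) : ℝ) : ℂ) * y))
      (Complex.exp (I * ((m / 2 * (sr - sr⁻¹) : ℝ) : ℂ) * x)
        * (I * ((m / 2 * (sr - sr⁻¹) : ℝ) : ℂ))) x := by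
    intro x
    have h := (Complex.ofRealCLM.hasDerivAt (x := x)).const_mul
      (I * ((m / 2 * (sr - sr⁻¹) : ℝ) : ℂ))
    simpa using h.cexp
  constructor
  · intro x
    have hd := ((hexp x).fun_mul (hsumd sr x)).congr_of_eventuallyEq (.of_forall hu)
    rw [hd.deriv, hu, hv]
    have h := hfirst sr hsr x
    push_cast
    linear_combination (Complex.exp (I * (m / 2 * (sr - (sr : ℂ)⁻¹)) * x)) * h
      - (Complex.exp (I * (m / 2 * (sr - (sr : ℂ)⁻¹)) * x)) * (m / 2 * (sr - (sr : ℂ)⁻¹))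
        * (1 + 2 * I / (m : ℂ) * ∑ l, (e l x : ℂ) * f x l / (s l - (sr : ℂ))) * Complex.I_mul_I
  · intro x
    have hd := ((hexp x).fun_mul (hVd x)).congr_of_eventuallyEq (.of_forall hv)
    rw [hd.deriv, hu, hv]
    have h := hsecond x
    push_cast
    linear_combination (Complex.exp (I * (m / 2 * (sr - (sr : ℂ)⁻¹)) * x)) * h
      + (Complex.exp (I * (m / 2 * (sr - (sr : ℂ)⁻¹)) * x)) * (m / 2 * (sr - (sr : ℂ)⁻¹))
        * ((sr : ℂ)⁻¹ + 2 * I / (m : ℂ)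
          * ∑ l, (e l x : ℂ) * s l * conj (f x l) / (s l - (sr : ℂ))) * Complex.I_mul_I
end

section
/- In the n-soliton setup, for every real s ≠ 0 the scattering-state amplitude |u(x,s)|² + |v(x,s)|² tends to 1 + s⁻² both as x → −∞ and as x → +∞, where u(x,s) = exp(i·k(s)·x)·[ 1 + (2i/m)·Σ_{j=1}^{n} e_j(x)·f_j(x)/(s_j − s) ] and v(x,s) = exp(i·k(s)·x)·[ s⁻¹ + (2i/m)·Σ_{j=1}^{n} e_j(x)·s_j·conj(f_j(x))/(s_j − s) ], with k(s) = (m/2)(s − s⁻¹). -/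
open Matrix Filter

/-- A Cauchy system `∑ l, g l / (x j - y l) = 0` has only the trivial solution. -/
theorem eq_zero_of_sum_div_sub_eq_zero {K ι : Type*} [Field K] [Fintype ι]
    {x y : ι → K} (hx : Function.Injective x) (hy : Function.Injective y)
    (hxy : ∀ j l, x j ≠ y l) {g : ι → K} (h : ∀ j, ∑ l, g l / (x j - y l) = 0) : g = 0 := by
  classical
  set p : Polynomial K := ∑ l, Polynomial.C (g l) *
    ∏ k ∈ Finset.univ.erase l, (Polynomial.X - Polynomial.C (y k)) with hp
  have hdeg : p.degree < (Finset.univ : Finset ι).card := by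
    refine (Polynomial.degree_sum_le _ _).trans_lt ?_
    rw [Finset.sup_lt_iff (WithBot.bot_lt_coe _)]
    intro l _
    refine (Polynomial.degree_mul_le _ _).trans_lt
      ((add_le_add_left Polynomial.degree_C_le _).trans_lt ?_)
    simp only [Polynomial.degree_prod, Polynomial.degree_X_sub_C, Finset.sum_const, zero_add,
      nsmul_one]
    exact_mod_cast Finset.card_erase_lt_of_mem (Finset.mem_univ l)
  have hp0 : p = 0 := by
    refine Polynomial.eq_zero_of_degree_lt_of_eval_index_eq_zero Finset.univ
      (v := x) hx.injOn hdeg fun j _ => ?_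
    have hterm : ∀ l, g l * ∏ k ∈ Finset.univ.erase l, (x j - y k)
        = g l / (x j - y l) * ∏ k, (x j - y k) := by
      intro l
      rw [← Finset.mul_prod_erase _ _ (Finset.mem_univ l)]
      have := sub_ne_zero.2 (hxy j l)
      field_simp
    simp [hp, Polynomial.eval_finsetSum, Polynomial.eval_prod, hterm, ← Finset.sum_mul, h j]
  funext l
  have hl : p.eval (y l) = g l * ∏ k ∈ Finset.univ.erase l, (y l - y k) := by
    simp only [hp, Polynomial.eval_finsetSum, Polynomial.eval_mul, Polynomial.eval_C,
      Polynomial.eval_prod, Polynomial.eval_sub, Polynomial.eval_X]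
    refine Finset.sum_eq_single l (fun k _ hk => ?_) (by simp)
    rw [Finset.prod_eq_zero (Finset.mem_erase.2 ⟨hk.symm, Finset.mem_univ l⟩) (sub_self _),
      mul_zero]
  rw [hp0, Polynomial.eval_zero] at hl
  refine (mul_eq_zero.1 hl.symm).resolve_right (Finset.prod_ne_zero_iff.2 fun k hk => ?_)
  exact sub_ne_zero.2 fun hlk => (Finset.mem_erase.1 hk).1 (hy hlk).symm

section Soliton

open Complex ComplexConjugate

variable {ι : Type*} [Fintype ι] {s : ι → ℂ} {c : ℝ}

theorem sub_ofReal_ne_zero_of_im_pos {z : ℂ} (hz : 0 < z.im) (t : ℝ) : z - t ≠ 0 := by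
  intro h
  simpa [hz.ne'] using congrArg Complex.im h

theorem conj_sub_ne_zero_of_im_pos {z w : ℂ} (hz : 0 < z.im) (hw : 0 < w.im) :
    conj z - w ≠ 0 := by
  intro h
  have := congrArg Complex.im h
  simp at this
  linarith

/-- The defect from unitarity of the soliton amplitude at a real spectral parameter. -/
theorem soliton_amplitude_norm_sq (hs : ∀ j, 0 < (s j).im) {e : ι → ℝ} {f : ι → ℂ}
    (hf : ∀ j, f j = e j * (-1 + c * I * ∑ l, e l * f l / (conj (s j) - s l))) (t : ℝ) :
    ‖1 + c * I * ∑ j, e j * f j / (s j - t)‖ ^ 2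
      = 1 - ∑ j, ‖f j‖ ^ 2 * (2 * c * (s j).im / ‖s j - t‖ ^ 2) := by
  have hne j : s j - t ≠ 0 := sub_ofReal_ne_zero_of_im_pos (hs j) t
  have hne' j : conj (s j) - t ≠ 0 := by
    simpa using (map_ne_zero (starRingEnd ℂ)).2 (hne j)
  have hq k l : conj (s k) - s l ≠ 0 := conj_sub_ne_zero_of_im_pos (hs k) (hs l)
  have hfc : ∀ l, conj (f l)
      = e l * (-1 + c * I * ∑ k, e k * conj (f k) / (conj (s k) - s l)) := by
    intro l
    have h := congrArg conj (hf l)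
    simp only [map_mul, map_add, map_neg, map_one, map_sum, map_div₀, map_sub, conj_conj,
      conj_ofReal, conj_I] at h
    rw [h]
    have : ∀ k, (e k : ℂ) * conj (f k) / (s l - conj (s k))
        = -(e k * conj (f k) / (conj (s k) - s l)) := by
      intro k
      rw [← neg_sub, div_neg]
    simp only [this, Finset.sum_neg_distrib]
    ring
  have hprod : (∑ l, e l * f l / (s l - t)) * ∑ k, e k * conj (f k) / (conj (s k) - t)
      = (∑ l, e l * f l / (s l - t) * ∑ k, e k * conj (f k) / (conj (s k) - s l))
        - ∑ k, e k * conj (f k) / (conj (s k) - t) * ∑ l, e l * f l / (conj (s k) - s l) := by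
    rw [Finset.sum_mul_sum]
    simp only [Finset.mul_sum]
    rw [Finset.sum_comm (f := fun k l => (e k : ℂ) * conj (f k) / (conj (s k) - t) *
      (e l * f l / (conj (s k) - s l)))]
    simp only [← Finset.sum_sub_distrib]
    refine Finset.sum_congr rfl fun l _ => Finset.sum_congr rfl fun k _ => ?_
    have h1 := hne l
    have h2 := hne' k
    have h3 := hq k l
    field_simp
    ring
  have hA : c * I * (∑ l, e l * f l / (s l - t) * ∑ k, e k * conj (f k) / (conj (s k) - s l))
      = ∑ l, (f l * conj (f l) / (s l - t) + e l * f l / (s l - t)) := by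
    rw [Finset.mul_sum]
    refine Finset.sum_congr rfl fun l _ => ?_
    linear_combination (-(f l) / (s l - t)) * hfc l
  have hB : c * I * (∑ k, e k * conj (f k) / (conj (s k) - t) *
        ∑ l, e l * f l / (conj (s k) - s l))
      = ∑ k, (f k * conj (f k) / (conj (s k) - t) + e k * conj (f k) / (conj (s k) - t)) := by
    rw [Finset.mul_sum]
    refine Finset.sum_congr rfl fun k _ => ?_
    linear_combination (-(conj (f k)) / (conj (s k) - t)) * hf k
  have hD : ∑ j, (‖f j‖ : ℂ) ^ 2 * (2 * c * (s j).im / ‖s j - t‖ ^ 2)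
      = c * I * (∑ j, f j * conj (f j) / (s j - t)
        - ∑ j, f j * conj (f j) / (conj (s j) - t)) := by
    rw [← Finset.sum_sub_distrib, Finset.mul_sum]
    refine Finset.sum_congr rfl fun j _ => ?_
    have h1 := hne j
    have h2 := hne' j
    have h3 : conj (s j) - s j = -(2 * I * (s j).im) := by
      rw [← neg_sub, sub_conj]
      push_cast
      ring
    rw [← mul_conj', ← mul_conj', map_sub, conj_ofReal]
    field_simp
    linear_combination (-I * f j * conj (f j) * c) * h3 + (2 * f j * conj (f j) * c * (s j).im) * I_sq
  rw [← ofReal_inj]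
  push_cast
  rw [hD, ← mul_conj']
  simp only [map_mul, map_add, map_one, map_sum, map_div₀, map_sub, conj_ofReal, conj_I]
  rw [Finset.sum_add_distrib] at hA hB
  linear_combination (-(c * I) ^ 2) * hprod - (c * I) * hA + (c * I) * hB

theorem soliton_norm_sq_le (hs : ∀ j, 0 < (s j).im) (hc : 0 < c) {e : ι → ℝ} {f : ι → ℂ}
    (hf : ∀ j, f j = e j * (-1 + c * I * ∑ l, e l * f l / (conj (s j) - s l))) (j : ι) :
    ‖f j‖ ^ 2 ≤ (2 * c * (s j).im / ‖s j‖ ^ 2)⁻¹ := by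
  have h := soliton_amplitude_norm_sq hs hf 0
  simp only [ofReal_zero, sub_zero] at h
  have hpos i : 0 < 2 * c * (s i).im / ‖s i‖ ^ 2 := by
    have hsi : s i ≠ 0 := by simpa using sub_ofReal_ne_zero_of_im_pos (hs i) 0
    have := hs i
    positivity
  have hle := Finset.single_le_sum (f := fun i => ‖f i‖ ^ 2 * (2 * c * (s i).im / ‖s i‖ ^ 2))
    (fun i _ => mul_nonneg (sq_nonneg _) (hpos i).le) (Finset.mem_univ j)
  rw [← one_div, le_div_iff₀ (hpos j)]
  refine hle.trans ?_
  linarith [sq_nonneg ‖1 + c * I * ∑ j, e j * f j / s j‖]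

variable {e : ℝ → ι → ℝ} {f : ℝ → ι → ℂ} {L : Filter ℝ}

theorem soliton_isBoundedUnder (hs : ∀ j, 0 < (s j).im) (hc : 0 < c)
    (hf : ∀ x j, f x j = e x j * (-1 + c * I * ∑ l, e x l * f x l / (conj (s j) - s l)))
    (j : ι) : IsBoundedUnder (· ≤ ·) L (norm ∘ fun x => f x j) :=
  isBoundedUnder_of ⟨√(2 * c * (s j).im / ‖s j‖ ^ 2)⁻¹, fun x =>
    Real.le_sqrt_of_sq_le (soliton_norm_sq_le hs hc (hf x) j)⟩

theorem soliton_tendsto_zero_of_tendsto_zero (hs : ∀ j, 0 < (s j).im) (hc : 0 < c)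
    (hf : ∀ x j, f x j = e x j * (-1 + c * I * ∑ l, e x l * f x l / (conj (s j) - s l)))
    (he : ∀ j, Tendsto (fun x => e x j) L (nhds 0)) (j : ι) :
    Tendsto (fun x => f x j) L (nhds 0) := by
  have he' l : Tendsto (fun x => (e x l : ℂ)) L (nhds 0) := by
    simpa [Function.comp_def] using (continuous_ofReal.tendsto 0).comp (he l)
  have hg l : Tendsto (fun x => e x l * f x l) L (nhds 0) :=
    (he' l).zero_mul_isBoundedUnder_le (soliton_isBoundedUnder hs hc hf l)
  have hsum : Tendsto (fun x => ∑ l, e x l * f x l / (conj (s j) - s l)) L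
      (nhds (∑ l, 0 / (conj (s j) - s l))) :=
    tendsto_finsetSum _ fun l _ => (hg l).div_const _
  have h := (he' j).mul ((hsum.const_mul (c * I)).const_add (-1))
  rw [zero_mul] at h
  exact h.congr fun x => (hf x j).symm

theorem soliton_tendsto_zero_of_tendsto_inv_zero (hs : ∀ j, 0 < (s j).im)
    (hinj : Function.Injective s) (hc : 0 < c)
    (hf : ∀ x j, f x j = e x j * (-1 + c * I * ∑ l, e x l * f x l / (conj (s j) - s l)))
    (he0 : ∀ x j, e x j ≠ 0) (he : ∀ j, Tendsto (fun x => (e x j)⁻¹) L (nhds 0)) (j : ι) :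
    Tendsto (fun x => f x j) L (nhds 0) := by
  classical
  have he' l : Tendsto (fun x => (e x l : ℂ)⁻¹) L (nhds 0) := by
    simpa [Function.comp_def] using (continuous_ofReal.tendsto 0).comp (he l)
  have he0' x l : (e x l : ℂ) ≠ 0 := ofReal_ne_zero.2 (he0 x l)
  have hcI : (c : ℂ) * I ≠ 0 := mul_ne_zero (ofReal_ne_zero.2 hc.ne') I_ne_zero
  let A : Matrix ι ι ℂ := Matrix.of fun j l => (conj (s j) - s l)⁻¹
  have hA : IsUnit A := by
    rw [← Matrix.mulVec_injective_iff_isUnit, ← Matrix.coe_mulVecLin, injective_iff_map_eq_zero]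
    intro g hg
    refine eq_zero_of_sum_div_sub_eq_zero (x := fun j => conj (s j)) (y := s)
      ((starRingEnd ℂ).injective.comp hinj) hinj
      (fun j l => sub_ne_zero.1 (conj_sub_ne_zero_of_im_pos (hs j) (hs l))) fun j => ?_
    have := congrFun hg j
    simpa [A, Matrix.mulVec, dotProduct, div_eq_inv_mul] using this
  have hsolve x : (fun l => e x l * f x l)
      = A⁻¹ *ᵥ fun l => (c * I)⁻¹ * (1 + (e x l : ℂ)⁻¹ * f x l) := by
    have h : A *ᵥ (fun l => e x l * f x l)
        = fun l => (c * I)⁻¹ * (1 + (e x l : ℂ)⁻¹ * f x l) := by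
      funext k
      rw [eq_inv_mul_iff_mul_eq₀ hcI, hf x k, inv_mul_cancel_left₀ (he0' x k)]
      simp [A, Matrix.mulVec, dotProduct, div_eq_inv_mul]
    rw [← h, Matrix.mulVec_mulVec, Matrix.nonsing_inv_mul _ ((Matrix.isUnit_iff_isUnit_det A).1 hA),
      Matrix.one_mulVec]
  have hr l : Tendsto (fun x => (c * I)⁻¹ * (1 + (e x l : ℂ)⁻¹ * f x l)) L
      (nhds ((c * I)⁻¹ * (1 + 0))) :=
    (((he' l).zero_mul_isBoundedUnder_le
      (soliton_isBoundedUnder hs hc hf l)).const_add 1).const_mul _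
  have hg : Tendsto (fun x => e x j * f x j) L
      (nhds (∑ l, A⁻¹ j l * ((c * I)⁻¹ * (1 + 0)))) :=
    (tendsto_finsetSum Finset.univ fun l _ => (hr l).const_mul (A⁻¹ j l)).congr
      fun x => (congrFun (hsolve x) j).symm
  have h := (he' j).mul hg
  rw [zero_mul] at h
  exact h.congr fun x => inv_mul_cancel_left₀ (he0' x j) _

theorem soliton_amplitude_tendsto (hs : ∀ j, 0 < (s j).im)
    (hf : ∀ x j, f x j = e x j * (-1 + c * I * ∑ l, e x l * f x l / (conj (s j) - s l)))
    (hf0 : ∀ j, Tendsto (fun x => f x j) L (nhds 0)) (t : ℝ) :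
    Tendsto (fun x => ‖1 + c * I * ∑ j, e x j * f x j / (s j - t)‖ ^ 2) L (nhds 1) := by
  simp only [soliton_amplitude_norm_sq hs (hf _) t]
  have h : Tendsto (fun x => ∑ j, ‖f x j‖ ^ 2 * (2 * c * (s j).im / ‖s j - t‖ ^ 2)) L
      (nhds (∑ j, ‖(0 : ℂ)‖ ^ 2 * (2 * c * (s j).im / ‖s j - t‖ ^ 2))) :=
    tendsto_finsetSum _ fun j _ => ((hf0 j).norm.pow 2).mul_const _
  simpa using h.const_sub 1

/-- Reflection `t ↦ t⁻¹` relates the two components of the scattering state. -/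
theorem soliton_amplitude_reflection (hs1 : ∀ j, conj (s j) = (s j)⁻¹)
    (hs : ∀ j, 0 < (s j).im) {t : ℝ} (ht : t ≠ 0) (e : ι → ℝ) (f : ι → ℂ) :
    (t : ℂ)⁻¹ + c * I * ∑ j, e j * s j * conj (f j) / (s j - t)
      = (t : ℂ)⁻¹ * conj (1 + c * I * ∑ j, e j * f j / (s j - (t⁻¹ : ℝ))) := by
  have ht' : (t : ℂ) ≠ 0 := ofReal_ne_zero.2 ht
  simp only [map_mul, map_add, map_one, map_sum, map_div₀, map_sub, conj_ofReal, conj_I]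
  have hterm j : (e j : ℂ) * conj (f j) / (conj (s j) - (t⁻¹ : ℝ))
      = -t * (e j * s j * conj (f j) / (s j - t)) := by
    have h0 : s j ≠ 0 := by simpa using sub_ofReal_ne_zero_of_im_pos (hs j) 0
    have h1 := sub_ofReal_ne_zero_of_im_pos (hs j) t
    have h2 : (t : ℂ) - s j ≠ 0 := sub_ne_zero.2 (sub_ne_zero.1 h1).symm
    have h3 : (s j)⁻¹ - (t : ℂ)⁻¹ = -((s j - t) / (s j * t)) := by
      field_simp
      ring
    rw [hs1, ofReal_inv, h3]
    field_simp
  simp only [hterm, ← Finset.mul_sum]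
  field_simp

end Soliton

/-- In the `n`-soliton setup, for every real `s ≠ 0` the scattering-state amplitude
`|u(x,s)|² + |v(x,s)|²` tends to `1 + s⁻²` as `x → ±∞`. -/
theorem nsoliton_scattering_amplitude_at_infinity
    (m : ℝ) (hm : 0 < m) (n : ℕ) (hn : 1 ≤ n)
    (θ xc : Fin n → ℝ) (hθ : ∀ j, θ j ∈ Set.Ioo 0 Real.pi)
    (hθinj : Function.Injective θ)
    (s : Fin n → ℂ) (hs : ∀ j, s j = Complex.exp (Complex.I * (θ j : ℂ)))
    (κ : Fin n → ℝ) (hκ : ∀ j, κ j = m * Real.sin (θ j))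
    (e : Fin n → ℝ → ℝ)
    (he : ∀ j x, e j x = Real.sqrt (κ j) * Real.exp (κ j * (x - xc j)))
    (G : ℝ → Matrix (Fin n) (Fin n) ℂ)
    (hG : ∀ x j l, G x j l
      = -(2 * Complex.I / (m : ℂ)) * (e j x : ℂ) * (e l x : ℂ) / ((s j)⁻¹ - s l))
    (hinv : ∀ x : ℝ, IsUnit (1 + G x))
    (f : ℝ → Fin n → ℂ)
    (hf : ∀ x : ℝ, (1 + G x) *ᵥ (f x) = fun j => -((e j x : ℂ)))
    (hfd : ∀ j, Differentiable ℝ (fun x => f x j))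
    (Δ : ℝ → ℂ)
    (hΔ : ∀ x : ℝ, Δ x = (m : ℂ) + 2 * Complex.I * ∑ j, (s j)⁻¹ * (e j x : ℂ) * f x j)
    (sr : ℝ) (hsr : sr ≠ 0) (u v : ℝ → ℂ)
    (hu : ∀ x : ℝ, u x = Complex.exp (Complex.I * ((m / 2 * (sr - sr⁻¹) : ℝ) : ℂ) * x)
      * (1 + (2 * Complex.I / (m : ℂ))
          * ∑ j, (e j x : ℂ) * f x j / (s j - (sr : ℂ))))
    (hv : ∀ x : ℝ, v x = Complex.exp (Complex.I * ((m / 2 * (sr - sr⁻¹) : ℝ) : ℂ) * x)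
      * (((sr : ℂ))⁻¹ + (2 * Complex.I / (m : ℂ))
          * ∑ j, (e j x : ℂ) * s j * (starRingEnd ℂ) (f x j) / (s j - (sr : ℂ)))) :
    Tendsto (fun x : ℝ => ‖u x‖ ^ 2 + ‖v x‖ ^ 2) atBot (nhds (1 + (sr⁻¹) ^ 2)) ∧
    Tendsto (fun x : ℝ => ‖u x‖ ^ 2 + ‖v x‖ ^ 2) atTop (nhds (1 + (sr⁻¹) ^ 2)) := by
  have hsin j : 0 < Real.sin (θ j) := Real.sin_pos_of_mem_Ioo (hθ j)
  have hsim j : 0 < (s j).im := by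
    rw [hs, mul_comm, Complex.exp_ofReal_mul_I_im]
    exact hsin j
  have hs1 j : (starRingEnd ℂ) (s j) = (s j)⁻¹ := by
    rw [hs, ← Complex.exp_conj, ← Complex.exp_neg]
    simp
  have hsinj : Function.Injective s := by
    intro i j hij
    refine hθinj (Real.injOn_cos ⟨(hθ i).1.le, (hθ i).2.le⟩ ⟨(hθ j).1.le, (hθ j).2.le⟩ ?_)
    have := congrArg Complex.re hij
    rwa [hs, hs, mul_comm, Complex.exp_ofReal_mul_I_re, mul_comm,
      Complex.exp_ofReal_mul_I_re] at this
  have hκpos j : 0 < κ j := by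
    rw [hκ]
    exact mul_pos hm (hsin j)
  have hc : 0 < 2 / m := by positivity
  have hcI : 2 * Complex.I / (m : ℂ) = ((2 / m : ℝ) : ℂ) * Complex.I := by
    push_cast
    ring
  have hf' : ∀ x j, f x j = (e j x : ℂ) * (-1 + ((2 / m : ℝ) : ℂ) * Complex.I *
      ∑ l, (e l x : ℂ) * f x l / ((starRingEnd ℂ) (s j) - s l)) := by
    intro x j
    have h := congrFun (hf x) j
    rw [Matrix.add_mulVec, Matrix.one_mulVec, Pi.add_apply] at h
    have hG' : (G x *ᵥ f x) j = -(((2 / m : ℝ) : ℂ) * Complex.I * (e j x : ℂ) *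
        ∑ l, (e l x : ℂ) * f x l / ((starRingEnd ℂ) (s j) - s l)) := by
      rw [Finset.mul_sum, ← Finset.sum_neg_distrib, Matrix.mulVec, dotProduct]
      refine Finset.sum_congr rfl fun l _ => ?_
      rw [hG, hcI, hs1]
      ring
    linear_combination h - hG'
  have hnorm (x : ℝ) : ‖Complex.exp (Complex.I * ((m / 2 * (sr - sr⁻¹) : ℝ) : ℂ) * x)‖ = 1 := by
    rw [mul_assoc, ← Complex.ofReal_mul, mul_comm, Complex.norm_exp_ofReal_mul_I]
  have hlim : ∀ L : Filter ℝ, (∀ j, Tendsto (fun x => f x j) L (nhds 0)) →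
      Tendsto (fun x : ℝ => ‖u x‖ ^ 2 + ‖v x‖ ^ 2) L (nhds (1 + (sr⁻¹) ^ 2)) := by
    intro L h0
    have h1 := soliton_amplitude_tendsto hsim hf' h0 sr
    have h2 := (soliton_amplitude_tendsto hsim hf' h0 sr⁻¹).const_mul (sr⁻¹ ^ 2)
    rw [mul_one] at h2
    refine (h1.add h2).congr fun x => ?_
    rw [hu, hv, hcI, soliton_amplitude_reflection hs1 hsim hsr (fun j => e j x) (f x)]
    simp only [norm_mul, hnorm, one_mul, RCLike.norm_conj, mul_pow, norm_inv, Complex.norm_real,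
      Real.norm_eq_abs, inv_pow, sq_abs]
  have hepos j x : 0 < e j x := by
    rw [he]
    have := hκpos j
    positivity
  refine ⟨hlim _ ?_, hlim _ ?_⟩
  · refine soliton_tendsto_zero_of_tendsto_zero (e := fun x j => e j x) hsim hc hf' fun j => ?_
    simp only [he]
    have h : Tendsto (fun x => κ j * (x - xc j)) atBot atBot :=
      (tendsto_id.atBot_add tendsto_const_nhds).const_mul_atBot (hκpos j)
    simpa using (Real.tendsto_exp_atBot.comp h).const_mul √(κ j)
  · refine soliton_tendsto_zero_of_tendsto_inv_zero (e := fun x j => e j x) hsim hsinj hc hf'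
      (fun x j => (hepos j x).ne') fun j => ?_
    simp only [he]
    have h : Tendsto (fun x => κ j * (x - xc j)) atTop atTop :=
      (tendsto_id.atTop_add tendsto_const_nhds).const_mul_atTop (hκpos j)
    exact ((Real.tendsto_exp_atTop.comp h).const_mul_atTop
      (Real.sqrt_pos.2 (hκpos j))).inv_tendsto_atTop
end

section
/- In the n-soliton setup, for every x ∈ ℝ the function s ↦ (m/2)·u(x,s)·conj(v(x,s)) − Δ(x)/(2s) is integrable on (−∞, 0) and on (0, ∞), and [ ∫_{−∞}^{0} ds/(2π) − ∫_{0}^{∞} ds/(2π) ] ( (m/2)·u(x,s)·conj(v(x,s)) − Δ(x)/(2s) ) = −Σ_{j=1}^{n} s_j⁻¹·f_j(x)²·(2θ_j − π)/π, where u(x,s) and v(x,s) are the scattering states u(x,s) = exp(i·k(s)·x)·[ 1 + (2i/m)·Σ_{j=1}^{n} e_j(x)·f_j(x)/(s_j − s) ] and v(x,s) = exp(i·k(s)·x)·[ s⁻¹ + (2i/m)·Σ_{j=1}^{n} e_j(x)·s_j·conj(f_j(x))/(s_j − s) ], with k(s) = (m/2)(s − s⁻¹). -/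
open Matrix MeasureTheory

/-- The Lorentzian (Poisson kernel) with pole at `exp (iθ)`. -/
noncomputable def lorentzian (θ t : ℝ) : ℝ :=
  Real.sin θ / ((t - Real.cos θ) ^ 2 + Real.sin θ ^ 2)

lemma hasDerivAt_arctan_lorentzian {θ : ℝ} (h : 0 < Real.sin θ) (t : ℝ) :
    HasDerivAt (fun t => Real.arctan ((t - Real.cos θ) / Real.sin θ)) (lorentzian θ t) t := by
  have h1 := (((hasDerivAt_id' t).sub_const (Real.cos θ)).div_const (Real.sin θ)).arctan
  convert h1 using 1
  have : 0 < (t - Real.cos θ) ^ 2 + Real.sin θ ^ 2 := by positivity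
  simp only [lorentzian]
  field_simp
  ring

lemma integrable_lorentzian {θ : ℝ} (h : 0 < Real.sin θ) : Integrable (lorentzian θ) := by
  have h1 := ((integrable_inv_one_add_sq.comp_div h.ne').comp_sub_right (Real.cos θ)).const_mul
    (Real.sin θ)⁻¹
  refine h1.congr (ae_of_all _ fun t => ?_)
  have : 0 < (t - Real.cos θ) ^ 2 + Real.sin θ ^ 2 := by positivity
  simp only [lorentzian]
  field_simp
  ring

lemma arctan_neg_cos_div_sin {θ : ℝ} (hθ : θ ∈ Set.Ioo 0 Real.pi) :
    Real.arctan ((0 - Real.cos θ) / Real.sin θ) = θ - Real.pi / 2 := by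
  have h : (0 - Real.cos θ) / Real.sin θ = Real.tan (θ - Real.pi / 2) := by
    rw [Real.tan_eq_sin_div_cos, Real.sin_sub_pi_div_two, Real.cos_sub_pi_div_two, zero_sub]
  rw [h, Real.arctan_tan] <;> linarith [hθ.1, hθ.2]

lemma integral_Iio_lorentzian {θ : ℝ} (hθ : θ ∈ Set.Ioo 0 Real.pi) :
    ∫ t in Set.Iio 0, lorentzian θ t = θ := by
  have h := Real.sin_pos_of_mem_Ioo hθ
  rw [← integral_Iic_eq_integral_Iio,
    integral_Iic_of_hasDerivAt_of_tendsto' (fun t _ => hasDerivAt_arctan_lorentzian h t)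
      (integrable_lorentzian h).integrableOn
      ((Real.tendsto_arctan_atBot.mono_right nhdsWithin_le_nhds).comp
        ((Filter.tendsto_atBot_add_const_right _ _ Filter.tendsto_id).atBot_div_const h)),
    arctan_neg_cos_div_sin hθ]
  ring

lemma integral_Ioi_lorentzian {θ : ℝ} (hθ : θ ∈ Set.Ioo 0 Real.pi) :
    ∫ t in Set.Ioi 0, lorentzian θ t = Real.pi - θ := by
  have h := Real.sin_pos_of_mem_Ioo hθ
  rw [integral_Ioi_of_hasDerivAt_of_tendsto' (fun t _ => hasDerivAt_arctan_lorentzian h t)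
      (integrable_lorentzian h).integrableOn
      ((Real.tendsto_arctan_atTop.mono_right nhdsWithin_le_nhds).comp
        ((Filter.tendsto_atTop_add_const_right _ _ Filter.tendsto_id).atTop_div_const h)),
    arctan_neg_cos_div_sin hθ]
  ring

lemma inv_sub_inv_eq_lorentzian {θ : ℝ} (h : 0 < Real.sin θ) {s : ℂ}
    (hs : s = Complex.exp (Complex.I * θ)) (t : ℝ) :
    (s⁻¹ - t)⁻¹ - (s - t)⁻¹ = 2 * Complex.I * lorentzian θ t := by
  have hs1 : s = Real.cos θ + Real.sin θ * Complex.I := by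
    rw [hs, mul_comm, Complex.exp_mul_I, Complex.ofReal_cos, Complex.ofReal_sin]
  have hs2 : s⁻¹ = Real.cos θ - Real.sin θ * Complex.I := by
    rw [hs, ← Complex.exp_neg, ← mul_neg, ← Complex.ofReal_neg, mul_comm, Complex.exp_mul_I,
      ← Complex.ofReal_cos, ← Complex.ofReal_sin]
    simp [sub_eq_add_neg]
  have h1 : (s - t) ≠ 0 := fun h0 => h.ne' (by
    simpa [hs1, -Complex.ofReal_sin, -Complex.ofReal_cos] using congrArg Complex.im h0)
  have h2 : (s⁻¹ - t) ≠ 0 := fun h0 => h.ne' (by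
    simpa [hs2, -Complex.ofReal_sin, -Complex.ofReal_cos] using congrArg Complex.im h0)
  have h3 : (s⁻¹ - t) * (s - t) = (((t - Real.cos θ) ^ 2 + Real.sin θ ^ 2 : ℝ) : ℂ) := by
    rw [hs2, hs1]
    push_cast
    linear_combination (-(Complex.sin θ) ^ 2) * Complex.I_sq
  rw [inv_sub_inv h2 h1, h3, lorentzian, hs2, hs1]
  push_cast
  ring

/-- Partial fractions for the product of the two scattering amplitudes, whose residues are
determined by the linear system `hf`. -/
lemma scattering_partial_fractions {ι : Type*} [Fintype ι] (a t : ℂ) (ht : t ≠ 0)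
    (s f e : ι → ℂ) (hs : ∀ j, s j ≠ 0) (hst : ∀ j, s j - t ≠ 0) (hst' : ∀ j, (s j)⁻¹ - t ≠ 0)
    (hss : ∀ j l, (s j)⁻¹ - s l ≠ 0)
    (hf : ∀ j, f j - a * e j * ∑ l, e l * f l / ((s j)⁻¹ - s l) = -e j) :
    (1 + a * ∑ j, e j * f j / (s j - t)) * (t⁻¹ - a * ∑ j, e j * (s j)⁻¹ * f j / ((s j)⁻¹ - t))
      = (1 + a * ∑ j, (s j)⁻¹ * e j * f j) / t
        + a * ∑ j, (s j)⁻¹ * f j ^ 2 * (((s j)⁻¹ - t)⁻¹ - (s j - t)⁻¹) := by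
  have key (j) : a * ∑ l, e j * f j * (e l * f l) / ((s j)⁻¹ - s l) = f j ^ 2 + e j * f j := by
    have : ∑ l, e j * f j * (e l * f l) / ((s j)⁻¹ - s l)
        = e j * f j * ∑ l, e l * f l / ((s j)⁻¹ - s l) := by
      rw [Finset.mul_sum]
      exact Finset.sum_congr rfl fun l _ => by ring
    rw [this]
    linear_combination (-f j) * hf j
  have hsymm (j l) : (s j)⁻¹ / ((s j)⁻¹ - s l) = (s l)⁻¹ / ((s l)⁻¹ - s j) := by
    have h1 := hss j l
    have h2 := hss l j
    rw [div_eq_div_iff h1 h2]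
    have := hs j
    have := hs l
    field_simp
  have hprod : (∑ l, e l * f l / (s l - t)) * ∑ j, e j * (s j)⁻¹ * f j / ((s j)⁻¹ - t)
      = (∑ j, (s j)⁻¹ / (s j - t) * ∑ l, e j * f j * (e l * f l) / ((s j)⁻¹ - s l))
        - ∑ j, (s j)⁻¹ / ((s j)⁻¹ - t) * ∑ l, e j * f j * (e l * f l) / ((s j)⁻¹ - s l) := by
    rw [Finset.sum_mul_sum, Finset.sum_comm]
    simp only [Finset.mul_sum]
    rw [Finset.sum_comm (f := fun j l =>
      (s j)⁻¹ / (s j - t) * (e j * f j * (e l * f l) / ((s j)⁻¹ - s l))), ← Finset.sum_sub_distrib]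
    refine Finset.sum_congr rfl fun l _ => ?_
    rw [← Finset.sum_sub_distrib]
    refine Finset.sum_congr rfl fun j _ => ?_
    have h1 := hst j
    have h2 := hst' l
    have h3 := hss l j
    trans e j * f j * (e l * f l) *
      ((s l)⁻¹ / ((s l)⁻¹ - s j) * ((s j - t)⁻¹ - ((s l)⁻¹ - t)⁻¹))
    · rw [inv_sub_inv h1 h2]
      generalize (s l)⁻¹ = r at h2 h3 ⊢
      field_simp
      ring
    · rw [mul_sub ((s l)⁻¹ / ((s l)⁻¹ - s j)), hsymm l j]
      nth_rewrite 2 [← hsymm l j]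
      ring
  have hprod' : a * ((∑ l, e l * f l / (s l - t)) * ∑ j, e j * (s j)⁻¹ * f j / ((s j)⁻¹ - t))
      = (∑ j, (s j)⁻¹ / (s j - t) * (f j ^ 2 + e j * f j))
        - ∑ j, (s j)⁻¹ / ((s j)⁻¹ - t) * (f j ^ 2 + e j * f j) := by
    simp only [hprod, mul_sub, ← key, mul_left_comm _ a]
    simp only [← Finset.mul_sum _ _ a]
  have hsum : t⁻¹ * (∑ j, e j * f j / (s j - t)) - (∑ j, e j * (s j)⁻¹ * f j / ((s j)⁻¹ - t))
      - ((∑ j, (s j)⁻¹ / (s j - t) * (f j ^ 2 + e j * f j))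
        - ∑ j, (s j)⁻¹ / ((s j)⁻¹ - t) * (f j ^ 2 + e j * f j))
      = t⁻¹ * (∑ j, (s j)⁻¹ * e j * f j)
        + ∑ j, (s j)⁻¹ * f j ^ 2 * (((s j)⁻¹ - t)⁻¹ - (s j - t)⁻¹) := by
    simp only [Finset.mul_sum, ← Finset.sum_sub_distrib, ← Finset.sum_add_distrib]
    refine Finset.sum_congr rfl fun j _ => ?_
    have h1 : t⁻¹ * (s j - t)⁻¹ - (s j)⁻¹ * (s j - t)⁻¹ = t⁻¹ * (s j)⁻¹ := by
      have := hs j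
      have := hst j
      field_simp
    linear_combination (e j * f j) * h1
  linear_combination a * hsum - a * hprod'

/-- In the `n`-soliton setup, for every `x` the function
`s ↦ (m/2)·u(x,s)·conj(v(x,s)) − Δ(x)/(2s)` is integrable on `(−∞,0)` and `(0,∞)`, and
`[∫_{−∞}^0 − ∫_0^∞] (ds/2π) ((m/2)·u·conj v − Δ/(2s)) = −Σ_j s_j⁻¹ f_j(x)² (2θ_j − π)/π`. -/
theorem nsoliton_scattering_integral
    (m : ℝ) (hm : 0 < m) (n : ℕ) (hn : 1 ≤ n)
    (θ xc : Fin n → ℝ) (hθ : ∀ j, θ j ∈ Set.Ioo 0 Real.pi)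
    (hθinj : Function.Injective θ)
    (s : Fin n → ℂ) (hs : ∀ j, s j = Complex.exp (Complex.I * (θ j : ℂ)))
    (κ : Fin n → ℝ) (hκ : ∀ j, κ j = m * Real.sin (θ j))
    (e : Fin n → ℝ → ℝ)
    (he : ∀ j x, e j x = Real.sqrt (κ j) * Real.exp (κ j * (x - xc j)))
    (G : ℝ → Matrix (Fin n) (Fin n) ℂ)
    (hG : ∀ x j l, G x j l
      = -(2 * Complex.I / (m : ℂ)) * (e j x : ℂ) * (e l x : ℂ) / ((s j)⁻¹ - s l))
    (hinv : ∀ x : ℝ, IsUnit (1 + G x))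
    (f : ℝ → Fin n → ℂ)
    (hf : ∀ x : ℝ, (1 + G x) *ᵥ (f x) = fun j => -((e j x : ℂ)))
    (hfd : ∀ j, Differentiable ℝ (fun x => f x j))
    (Δ : ℝ → ℂ)
    (hΔ : ∀ x : ℝ, Δ x = (m : ℂ) + 2 * Complex.I * ∑ j, (s j)⁻¹ * (e j x : ℂ) * f x j)
    (u v : ℝ → ℝ → ℂ)
    (hu : ∀ (x : ℝ) (sr : ℝ),
      u x sr = Complex.exp (Complex.I * ((m / 2 * (sr - sr⁻¹) : ℝ) : ℂ) * x)
        * (1 + (2 * Complex.I / (m : ℂ))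
            * ∑ j, (e j x : ℂ) * f x j / (s j - (sr : ℂ))))
    (hv : ∀ (x : ℝ) (sr : ℝ),
      v x sr = Complex.exp (Complex.I * ((m / 2 * (sr - sr⁻¹) : ℝ) : ℂ) * x)
        * (((sr : ℂ))⁻¹ + (2 * Complex.I / (m : ℂ))
            * ∑ j, (e j x : ℂ) * s j * (starRingEnd ℂ) (f x j) / (s j - (sr : ℂ)))) :
    ∀ x : ℝ,
      IntegrableOn (fun sr : ℝ =>
          ((m : ℂ) / 2) * u x sr * (starRingEnd ℂ) (v x sr) - Δ x / (2 * (sr : ℂ)))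
        (Set.Iio 0) ∧
      IntegrableOn (fun sr : ℝ =>
          ((m : ℂ) / 2) * u x sr * (starRingEnd ℂ) (v x sr) - Δ x / (2 * (sr : ℂ)))
        (Set.Ioi 0) ∧
      (1 / (2 * (Real.pi : ℂ)))
          * ((∫ sr in Set.Iio (0 : ℝ),
                (((m : ℂ) / 2) * u x sr * (starRingEnd ℂ) (v x sr)
                  - Δ x / (2 * (sr : ℂ))))
            - (∫ sr in Set.Ioi (0 : ℝ),
                (((m : ℂ) / 2) * u x sr * (starRingEnd ℂ) (v x sr)
                  - Δ x / (2 * (sr : ℂ)))))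
        = -∑ j, (s j)⁻¹ * (f x j) ^ 2
            * (((2 * θ j - Real.pi) / Real.pi : ℝ) : ℂ) := by
  intro x
  have hsin (j) : 0 < Real.sin (θ j) := Real.sin_pos_of_mem_Ioo (hθ j)
  have hmC : (m : ℂ) ≠ 0 := by exact_mod_cast hm.ne'
  have hs0 (j) : s j ≠ 0 := by rw [hs]; exact Complex.exp_ne_zero _
  have hconj (j) : (starRingEnd ℂ) (s j) = (s j)⁻¹ := by
    rw [hs, ← Complex.exp_conj, ← Complex.exp_neg]
    simp
  have him (j) : 0 < (s j).im := by
    rw [hs, mul_comm, Complex.exp_ofReal_mul_I_im]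
    exact hsin j
  have him' (j) : (s j)⁻¹.im < 0 := by
    rw [← hconj, Complex.conj_im]
    linarith [him j]
  have hst (j) (t : ℝ) : s j - t ≠ 0 := fun h => by
    have := congrArg Complex.im h
    simp only [Complex.sub_im, Complex.ofReal_im, Complex.zero_im] at this
    linarith [him j]
  have hst' (j) (t : ℝ) : (s j)⁻¹ - t ≠ 0 := fun h => by
    have := congrArg Complex.im h
    simp only [Complex.sub_im, Complex.ofReal_im, Complex.zero_im] at this
    linarith [him' j]
  have hss (j l) : (s j)⁻¹ - s l ≠ 0 := fun h => by
    have := congrArg Complex.im h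
    simp only [Complex.sub_im, Complex.zero_im] at this
    linarith [him' j, him l]
  have hfx (j) : f x j - 2 * Complex.I / m * e j x * ∑ l, e l x * f x l / ((s j)⁻¹ - s l)
      = -(e j x : ℂ) := by
    have h := congrFun (hf x) j
    rw [Matrix.add_mulVec, Matrix.one_mulVec, Pi.add_apply, Matrix.mulVec, dotProduct] at h
    rw [← h, sub_eq_add_neg, ← neg_mul, Finset.mul_sum]
    congr 1
    refine Finset.sum_congr rfl fun l _ => ?_
    rw [hG]
    ring
  have integrand_eq (t : ℝ) (ht : t ≠ 0) :
      (m : ℂ) / 2 * u x t * (starRingEnd ℂ) (v x t) - Δ x / (2 * (t : ℂ))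
        = ∑ j, -2 * ((s j)⁻¹ * f x j ^ 2) * (lorentzian (θ j) t : ℂ) := by
    have htC : (t : ℂ) ≠ 0 := by exact_mod_cast ht
    have hphase : Complex.exp (Complex.I * ((m / 2 * (t - t⁻¹) : ℝ) : ℂ) * x)
        * (starRingEnd ℂ) (Complex.exp (Complex.I * ((m / 2 * (t - t⁻¹) : ℝ) : ℂ) * x)) = 1 := by
      rw [← Complex.exp_conj, ← Complex.exp_add, map_mul, map_mul, Complex.conj_I,
        Complex.conj_ofReal, Complex.conj_ofReal, neg_mul, neg_mul, add_neg_cancel,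
        Complex.exp_zero]
    have hv' : (starRingEnd ℂ) ((t : ℂ)⁻¹ + (2 * Complex.I / (m : ℂ))
            * ∑ j, (e j x : ℂ) * s j * (starRingEnd ℂ) (f x j) / (s j - (t : ℂ)))
        = (t : ℂ)⁻¹ - 2 * Complex.I / m
            * ∑ j, (e j x : ℂ) * (s j)⁻¹ * f x j / ((s j)⁻¹ - t) := by
      simp only [map_add, map_mul, map_div₀, map_sum, map_sub, map_inv₀, Complex.conj_ofReal,
        Complex.conj_conj, hconj, Complex.conj_I, map_ofNat]
      ring
    have hpf := scattering_partial_fractions (2 * Complex.I / m) t htC s (f x)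
      (fun j => (e j x : ℂ)) hs0 (fun j => hst j t) (fun j => hst' j t) hss hfx
    simp only [inv_sub_inv_eq_lorentzian (hsin _) (hs _)] at hpf
    have hsum : ∑ j, (s j)⁻¹ * f x j ^ 2 * (2 * Complex.I * (lorentzian (θ j) t : ℂ))
        = -Complex.I * ∑ j, -2 * ((s j)⁻¹ * f x j ^ 2) * (lorentzian (θ j) t : ℂ) := by
      rw [Finset.mul_sum]
      exact Finset.sum_congr rfl fun j _ => by ring
    have hΔ' : Δ x = m * (1 + 2 * Complex.I / m * ∑ j, (s j)⁻¹ * e j x * f x j) := by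
      rw [hΔ]
      field_simp
    rw [hsum] at hpf
    rw [hu, hv, map_mul, hv', hΔ']
    have hmm : (m : ℂ) * (2 * Complex.I / m) = 2 * Complex.I := by field_simp
    generalize Complex.exp (Complex.I * ((m / 2 * (t - t⁻¹) : ℝ) : ℂ) * x) = E at hphase ⊢
    linear_combination (m / 2 * ((1 + 2 * Complex.I / m * ∑ j, e j x * f x j / (s j - t))
        * ((t : ℂ)⁻¹ - 2 * Complex.I / m
            * ∑ j, (e j x : ℂ) * (s j)⁻¹ * f x j / ((s j)⁻¹ - t)))) * hphase + m / 2 * hpf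
      - (Complex.I / 2 * ∑ j, -2 * ((s j)⁻¹ * f x j ^ 2) * (lorentzian (θ j) t : ℂ)) * hmm
      - (∑ j, -2 * ((s j)⁻¹ * f x j ^ 2) * (lorentzian (θ j) t : ℂ)) * Complex.I_sq
  have hterm (j) : Integrable fun t : ℝ =>
      -2 * ((s j)⁻¹ * f x j ^ 2) * (lorentzian (θ j) t : ℂ) :=
    (integrable_lorentzian (hsin j)).ofReal.const_mul _
  have hIio : Set.EqOn (fun t : ℝ =>
      (m : ℂ) / 2 * u x t * (starRingEnd ℂ) (v x t) - Δ x / (2 * (t : ℂ)))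
      (fun t => ∑ j, -2 * ((s j)⁻¹ * f x j ^ 2) * (lorentzian (θ j) t : ℂ)) (Set.Iio 0) :=
    fun t ht => integrand_eq t (Set.mem_Iio.1 ht).ne
  have hIoi : Set.EqOn (fun t : ℝ =>
      (m : ℂ) / 2 * u x t * (starRingEnd ℂ) (v x t) - Δ x / (2 * (t : ℂ)))
      (fun t => ∑ j, -2 * ((s j)⁻¹ * f x j ^ 2) * (lorentzian (θ j) t : ℂ)) (Set.Ioi 0) :=
    fun t ht => integrand_eq t (Set.mem_Ioi.1 ht).ne'
  have hall := integrable_finsetSum Finset.univ fun j _ => hterm j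
  refine ⟨hall.integrableOn.congr_fun hIio.symm measurableSet_Iio,
    hall.integrableOn.congr_fun hIoi.symm measurableSet_Ioi, ?_⟩
  rw [setIntegral_congr_fun measurableSet_Iio hIio, setIntegral_congr_fun measurableSet_Ioi hIoi,
    integral_finsetSum _ fun j _ => (hterm j).integrableOn,
    integral_finsetSum _ fun j _ => (hterm j).integrableOn, ← Finset.sum_sub_distrib,
    Finset.mul_sum, ← Finset.sum_neg_distrib]
  refine Finset.sum_congr rfl fun j _ => ?_
  rw [integral_const_mul, integral_const_mul, integral_complex_ofReal, integral_complex_ofReal,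
    integral_Iio_lorentzian (hθ j), integral_Ioi_lorentzian (hθ j)]
  have hpi : (Real.pi : ℂ) ≠ 0 := by exact_mod_cast Real.pi_ne_zero
  push_cast
  field_simp
  ring
end

section
/- In the n-soliton setup, the functions x ↦ f₁(x)², …, x ↦ fₙ(x)² are linearly independent over ℂ: if c₁, …, cₙ ∈ ℂ satisfy Σ_{j=1}^{n} c_j·f_j(x)² = 0 for all x ∈ ℝ, then c₁ = … = cₙ = 0. -/
open Matrix

open Filter Topology ComplexConjugate

/-- A Cauchy system `∑ k, v k / (s k - t j) = 0` with distinct nodes has only the zero solution. -/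
lemma eq_zero_of_cauchy_sum_eq_zero {ι K : Type*} [Fintype ι] [DecidableEq ι] [Field K]
    {s t v : ι → K} (hs : Function.Injective s) (ht : Function.Injective t)
    (hst : ∀ k j, s k - t j ≠ 0) (h : ∀ j, ∑ k, v k / (s k - t j) = 0) : v = 0 := by
  set p : Polynomial K :=
    ∑ k, Polynomial.C (v k) * Lagrange.nodal (Finset.univ.erase k) s with hp
  have hdeg : p.degree < (Finset.univ : Finset ι).card := by
    rcases isEmpty_or_nonempty ι with hι | hι
    · simp [hp]
    refine (Polynomial.degree_sum_le _ _).trans_lt ?_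
    rw [Finset.sup_lt_iff (by simp)]
    intro k hk
    rw [← Polynomial.smul_eq_C_mul]
    refine (Polynomial.degree_smul_le _ _).trans_lt ?_
    rw [Lagrange.degree_nodal]
    exact_mod_cast Finset.card_erase_lt_of_mem hk
  have hzero : p = 0 := by
    refine Polynomial.eq_zero_of_degree_lt_of_eval_index_eq_zero (v := t) (s := Finset.univ)
      ht.injOn hdeg fun j _ => ?_
    have key : p.eval (t j) = -((∏ i, (t j - s i)) * ∑ k, v k / (s k - t j)) := by
      rw [hp, Polynomial.eval_finsetSum, Finset.mul_sum, ← Finset.sum_neg_distrib]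
      refine Finset.sum_congr rfl fun k _ => ?_
      rw [Polynomial.eval_mul, Polynomial.eval_C, Lagrange.eval_nodal,
        ← Finset.mul_prod_erase _ _ (Finset.mem_univ k)]
      have := hst k j
      field_simp
      ring
    rw [key, h j]
    simp
  funext k
  have hk : p.eval (s k) = v k * ∏ i ∈ Finset.univ.erase k, (s k - s i) := by
    rw [hp, Polynomial.eval_finsetSum, Finset.sum_eq_single k]
    · simp [Lagrange.eval_nodal]
    · intro i _ hik
      rw [Polynomial.eval_mul, Lagrange.eval_nodal_at_node (by simp [hik.symm]), mul_zero]
    · simp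
  rw [hzero, Polynomial.eval_zero] at hk
  refine (mul_eq_zero.mp hk.symm).resolve_right (Finset.prod_ne_zero_iff.mpr fun i hi => ?_)
  exact sub_ne_zero.mpr (hs.ne (Finset.ne_of_mem_erase hi).symm)

/-- No entry of the solution of a Cauchy system with nonzero constant right-hand side vanishes. -/
lemma ne_zero_of_cauchy_sum_eq_const {ι K : Type*} [Fintype ι] [DecidableEq ι] [Field K]
    {s t b : ι → K} {r : K} (hs : Function.Injective s) (ht : Function.Injective t)
    (hst : ∀ k j, s k - t j ≠ 0) (hr : r ≠ 0) (h : ∀ j, ∑ k, b k / (s k - t j) = r) (l : ι) :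
    b l ≠ 0 := by
  intro hl
  have h' : ∀ j, ∑ k ∈ Finset.univ.erase l, b k / (s k - t j) = r := fun j => by
    rw [← h j, ← Finset.add_sum_erase _ _ (Finset.mem_univ l), hl]
    simp
  have hv := eq_zero_of_cauchy_sum_eq_zero (v := fun k => if k = l then
    r - ∑ i ∈ Finset.univ.erase l, b i / (s i - s l) else b k / (s k - s l)) hs ht hst (by
      intro j
      rw [← Finset.add_sum_erase _ _ (Finset.mem_univ l), if_pos rfl]
      have hlj := hst l j
      have : ∑ k ∈ Finset.univ.erase l, (if k = l then
          r - ∑ i ∈ Finset.univ.erase l, b i / (s i - s l) else b k / (s k - s l)) / (s k - t j)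
          = (∑ i ∈ Finset.univ.erase l, b i / (s i - s l) - r) / (s l - t j) := by
        trans (∑ i ∈ Finset.univ.erase l, b i / (s i - s l)
          - ∑ k ∈ Finset.univ.erase l, b k / (s k - t j)) / (s l - t j)
        swap
        · rw [h' j]
        rw [← Finset.sum_sub_distrib, Finset.sum_div]
        refine Finset.sum_congr rfl fun k hk => ?_
        have hkl := Finset.ne_of_mem_erase hk
        have h1 : s k - s l ≠ 0 := sub_ne_zero.mpr (hs.ne hkl)
        have h2 := hst k j
        rw [if_neg hkl]
        field_simp
        ring
      rw [this]
      ring)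
  have hb : ∀ k, b k = 0 := fun k => by
    by_cases hk : k = l
    · rw [hk, hl]
    · have h1 : s k - s l ≠ 0 := sub_ne_zero.mpr (hs.ne hk)
      have := congrFun hv k
      simpa [hk, h1] using this
  exact hr (by rw [← h l]; simp [hb])

/-- The phase of the solution of the Cauchy system of an `n`-soliton: up to a common factor, the
square of the `j`-th entry is a nonnegative multiple of `s j ^ 2`. -/
lemma exists_eq_mul_sq_mul_conj {ι : Type*} [Fintype ι] [DecidableEq ι] {m : ℝ} (hm : m ≠ 0)
    {s b : ι → ℂ} (hs : Function.Injective s) (hconj : ∀ j, conj (s j) = (s j)⁻¹)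
    (hs0 : ∀ j, s j ≠ 0) (hst : ∀ k j, s k - (s j)⁻¹ ≠ 0)
    (hb : ∀ j, ∑ k, (2 * Complex.I / (m : ℂ)) * b k / (s k - (s j)⁻¹) = 1) :
    ∃ μ : ℂ, ∀ j, b j = μ * s j ^ 2 * conj (b j) := by
  set a : ℂ := 2 * Complex.I / (m : ℂ) with ha
  have ha0 : a ≠ 0 := by simp [ha, hm]
  have hca : conj a = -a := by
    simp [ha, neg_div, Complex.conj_ofNat]
  have hb1 : ∀ j, ∑ k, a * (b k / s k) / (s k - (s j)⁻¹) = s j * (1 - a * ∑ k, b k / s k) := by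
    intro j
    rw [← hb j, Finset.mul_sum, ← Finset.sum_sub_distrib, Finset.mul_sum]
    refine Finset.sum_congr rfl fun k _ => ?_
    have h1 := hst k j
    have h2 := hs0 j
    have h3 := hs0 k
    have h5 : s k * s j - 1 ≠ 0 := fun h => h1 (by
      field_simp
      rw [h, mul_zero])
    field_simp
    ring
  have hb2 : ∀ j, ∑ k, a * (s k * conj (b k)) / (s k - (s j)⁻¹) = s j := by
    intro j
    have h0 := congrArg (fun z => s j * conj z) (hb j)
    simp only [map_sum, map_one, mul_one, Finset.mul_sum] at h0
    refine Eq.trans ?_ h0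
    refine Finset.sum_congr rfl fun k _ => ?_
    have h1 := hst k j
    have h4 := hst j k
    have h2 := hs0 j
    have h3 := hs0 k
    rw [map_div₀, map_mul, map_sub, map_inv₀, hconj, hconj, hca, inv_inv, mul_div_assoc',
      div_eq_div_iff h1 (by rw [← neg_sub]; exact neg_ne_zero.mpr h4)]
    field_simp
    ring
  refine ⟨1 - a * ∑ k, b k / s k, fun j => ?_⟩
  set μ : ℂ := 1 - a * ∑ k, b k / s k with hμ
  have hv := eq_zero_of_cauchy_sum_eq_zero (t := fun j => (s j)⁻¹)
    (v := fun k => a * (b k / s k) - μ * (a * (s k * conj (b k))))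
    hs (inv_injective.comp hs) hst (by
      intro j
      simp_rw [sub_div, mul_div_assoc μ]
      rw [Finset.sum_sub_distrib, ← Finset.mul_sum, hb1, hb2]
      ring)
  have hj : a * (b j / s j) - μ * (a * (s j * conj (b j))) = 0 := congrFun hv j
  have h3 := hs0 j
  have h5 : a * (b j / s j - μ * (s j * conj (b j))) = 0 := by rw [← hj]; ring
  have h6 := sub_eq_zero.mp ((mul_eq_zero.mp h5).resolve_left ha0)
  rw [div_eq_iff h3] at h6
  linear_combination h6

/-- The solution of a linear system converges when its matrix converges to an invertible one. -/
lemma tendsto_of_mulVec_eq {X ι K : Type*} [Fintype ι] [DecidableEq ι] [Field K]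
    [TopologicalSpace K] [IsTopologicalDivisionRing K] [T1Space K]
    {M : X → Matrix ι ι K} {M₀ : Matrix ι ι K} {u : X → ι → K} {w : ι → K} {l : Filter X}
    (hM : Tendsto M l (𝓝 M₀)) (h₀ : M₀.det ≠ 0) (h : ∀ x, M x *ᵥ u x = w) :
    Tendsto u l (𝓝 (M₀⁻¹ *ᵥ w)) := by
  have hdet : Tendsto (fun x => (M x).det) l (𝓝 M₀.det) :=
    ((continuous_id.matrix_det).tendsto M₀).comp hM
  have hadj : Tendsto (fun x => (M x).adjugate *ᵥ w) l (𝓝 (M₀.adjugate *ᵥ w)) :=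
    ((continuous_id.matrix_adjugate.matrix_mulVec continuous_const).tendsto M₀).comp hM
  have hlim := (hdet.inv₀ h₀).smul hadj
  rw [Matrix.inv_def, Ring.inverse_eq_inv', Matrix.smul_mulVec]
  refine hlim.congr' ?_
  filter_upwards [hdet.eventually_ne h₀] with x hx
  rw [← h x, Matrix.mulVec_mulVec, Matrix.adjugate_mul, Matrix.smul_mulVec, Matrix.one_mulVec,
    inv_smul_smul₀ hx]

/-- Among decaying exponentials only the one with zero rate survives at `-∞`. -/
lemma tendsto_mul_exp_atBot {c y : ℂ} {u : ℝ → ℂ} {k : ℝ} (hk : c ≠ 0 → 0 ≤ k)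
    (hu : Tendsto u atBot (𝓝 y)) :
    Tendsto (fun x => c * u x * (Real.exp (2 * k * x) : ℂ)) atBot
      (𝓝 (if k = 0 then c * y else 0)) := by
  by_cases hc : c = 0
  · simp [hc]
  split_ifs with h
  · simpa [h] using hu.const_mul c
  · have hpos : 0 < 2 * k := by
      have := lt_of_le_of_ne (hk hc) (Ne.symm h)
      linarith
    have h1 : Tendsto (fun x : ℝ => Real.exp (2 * k * x)) atBot (𝓝 0) :=
      Real.tendsto_exp_atBot.comp (tendsto_id.const_mul_atBot hpos)
    have h2 : Tendsto (fun x : ℝ => (Real.exp (2 * k * x) : ℂ)) atBot (𝓝 0) := by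
      exact_mod_cast (Complex.continuous_ofReal.tendsto 0).comp h1
    simpa using (hu.const_mul c).mul h2

/-- Two positively weighted relations, with and without the phases `exp (2 i θ j)`, cannot both hold
on a set of angles with the same sine. -/
lemma eq_zero_of_phase_relations {ι : Type*} [Fintype ι] [DecidableEq ι] {θ P Q : ι → ℝ}
    (hθ : ∀ j, θ j ∈ Set.Ioo 0 Real.pi) (hθinj : Function.Injective θ)
    (hP : ∀ j, 0 < P j) (hQ : ∀ j, 0 < Q j) {c : ι → ℂ} (i : ι)
    (h1 : ∑ j, (if Real.sin (θ j) = Real.sin (θ i) then c j * (P j : ℂ) else 0) = 0)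
    (h2 : ∑ j, (if Real.sin (θ j) = Real.sin (θ i) then
      c j * ((Q j : ℂ) * Complex.exp (Complex.I * (θ j : ℂ)) ^ 2) else 0) = 0) : c i = 0 := by
  have hsin : ∀ j, Real.sin (θ j) = Real.sin (θ i) → j ≠ i → θ j = Real.pi - θ i := by
    intro j hj hji
    by_contra hne
    have hθne : θ j ≠ θ i := hθinj.ne hji
    have hcos : Real.cos (θ j) ^ 2 = Real.cos (θ i) ^ 2 := by
      rw [Real.cos_sq', Real.cos_sq', hj]
    rcases sq_eq_sq_iff_eq_or_eq_neg.mp hcos with h | h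
    · exact hθne (Real.injOn_cos (Set.Ioo_subset_Icc_self (hθ j))
        (Set.Ioo_subset_Icc_self (hθ i)) h)
    · rw [← Real.cos_pi_sub] at h
      refine hne (Real.injOn_cos (Set.Ioo_subset_Icc_self (hθ j)) ?_ h)
      have := hθ i
      exact ⟨by linarith [this.2], by linarith [this.1]⟩
  have hPc : ∀ j, (P j : ℂ) ≠ 0 := fun j => by exact_mod_cast (hP j).ne'
  by_cases hex : ∃ j, Real.sin (θ j) = Real.sin (θ i) ∧ j ≠ i
  · obtain ⟨j, hj, hji⟩ := hex
    have hother : ∀ l, l ≠ i ∧ l ≠ j → ¬ Real.sin (θ l) = Real.sin (θ i) := fun l hl h =>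
      hl.2 (hθinj ((hsin l h hl.1).trans (hsin j hj hji).symm))
    rw [Fintype.sum_eq_add i j hji.symm (fun l hl => if_neg (hother l hl)), if_pos rfl,
      if_pos hj] at h1 h2
    by_contra hc
    set z : ℂ := Complex.exp (Complex.I * (θ i : ℂ)) with hz
    have hz0 : z ≠ 0 := Complex.exp_ne_zero _
    have hzj : Complex.exp (Complex.I * (θ j : ℂ)) = -z⁻¹ := by
      rw [hsin j hj hji, hz, ← Complex.exp_neg, Complex.ofReal_sub, mul_sub, Complex.exp_sub,
        mul_comm Complex.I (Real.pi : ℂ), Complex.exp_pi_mul_I, Complex.exp_neg, div_eq_mul_inv]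
      ring
    rw [hzj] at h2
    have hpow : z ^ 4 * ((Q i * P j : ℝ) : ℂ) = ((Q j * P i : ℝ) : ℂ) := by
      have h3 : c i * (z ^ 4 * (Q i * P j) - Q j * P i) = 0 := by
        have h2' : c i * (Q i * z ^ 4) + c j * Q j = 0 := by
          have := congrArg (· * z ^ 2) h2
          field_simp at this
          linear_combination this
        linear_combination (P j : ℂ) * h2' - (Q j : ℂ) * h1
      push_cast
      exact sub_eq_zero.mp ((mul_eq_zero.mp h3).resolve_left hc)
    have hnorm : Q i * P j = Q j * P i := by
      have := congrArg (‖·‖) hpow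
      have hz1 : ‖z‖ = 1 := by rw [hz, mul_comm]; exact Complex.norm_exp_ofReal_mul_I _
      simpa only [norm_mul, norm_pow, hz1, one_pow, one_mul, Complex.norm_real, Real.norm_eq_abs,
        abs_of_pos (hQ _), abs_of_pos (hP _)] using this
    rw [← hnorm] at hpow
    have hne : ((Q i * P j : ℝ) : ℂ) ≠ 0 := by exact_mod_cast (mul_pos (hQ i) (hP j)).ne'
    have hz4 : z ^ 4 = 1 := by
      have : z ^ 4 * ((Q i * P j : ℝ) : ℂ) = 1 * ((Q i * P j : ℝ) : ℂ) := by rw [hpow, one_mul]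
      exact mul_right_cancel₀ hne this
    have hfac : (z - 1) * ((z + 1) * (z ^ 2 + 1)) = 0 := by linear_combination hz4
    have him : z.im = Real.sin (θ i) := by
      rw [hz, mul_comm, Complex.exp_ofReal_mul_I_im]
    have hspos : 0 < z.im := him ▸ Real.sin_pos_of_mem_Ioo (hθ i)
    have hsq : z ^ 2 + 1 = 0 := by
      refine ((mul_eq_zero.mp ((mul_eq_zero.mp hfac).resolve_left fun h => ?_)).resolve_left
        fun h => ?_)
      · rw [sub_eq_zero.mp h] at hspos; simp at hspos
      · rw [eq_neg_of_add_eq_zero_left h] at hspos; simp at hspos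
    have hzz : z = -z⁻¹ := by
      field_simp
      linear_combination hsq
    have hcos : Real.cos (θ i) = Real.cos (θ j) := by
      have h4 := congrArg Complex.re (hzz.trans hzj.symm)
      rwa [hz, mul_comm, Complex.exp_ofReal_mul_I_re, mul_comm Complex.I,
        Complex.exp_ofReal_mul_I_re] at h4
    exact hji (hθinj (Real.injOn_cos (Set.Ioo_subset_Icc_self (hθ i))
      (Set.Ioo_subset_Icc_self (hθ j)) hcos)).symm
  · push Not at hex
    rw [Fintype.sum_eq_single i (fun j hj => if_neg fun h => hj (hex j h)), if_pos rfl] at h1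
    exact (mul_eq_zero.mp h1).resolve_right (hPc i)

/-- In the `n`-soliton setup, the functions `x ↦ f₁(x)², …, x ↦ fₙ(x)²` are linearly
independent over `ℂ`. -/
theorem nsoliton_fsq_linear_independent
    (m : ℝ) (hm : 0 < m) (n : ℕ) (hn : 1 ≤ n)
    (θ xc : Fin n → ℝ) (hθ : ∀ j, θ j ∈ Set.Ioo 0 Real.pi)
    (hθinj : Function.Injective θ)
    (s : Fin n → ℂ) (hs : ∀ j, s j = Complex.exp (Complex.I * (θ j : ℂ)))
    (κ : Fin n → ℝ) (hκ : ∀ j, κ j = m * Real.sin (θ j))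
    (e : Fin n → ℝ → ℝ)
    (he : ∀ j x, e j x = Real.sqrt (κ j) * Real.exp (κ j * (x - xc j)))
    (G : ℝ → Matrix (Fin n) (Fin n) ℂ)
    (hG : ∀ x j l, G x j l
      = -(2 * Complex.I / (m : ℂ)) * (e j x : ℂ) * (e l x : ℂ) / ((s j)⁻¹ - s l))
    (hinv : ∀ x : ℝ, IsUnit (1 + G x))
    (f : ℝ → Fin n → ℂ)
    (hf : ∀ x : ℝ, (1 + G x) *ᵥ (f x) = fun j => -((e j x : ℂ)))
    (hfd : ∀ j, Differentiable ℝ (fun x => f x j))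
    (Δ : ℝ → ℂ)
    (hΔ : ∀ x : ℝ, Δ x = (m : ℂ) + 2 * Complex.I * ∑ j, (s j)⁻¹ * (e j x : ℂ) * f x j)
    :
    ∀ c : Fin n → ℂ, (∀ x : ℝ, ∑ j, c j * (f x j) ^ 2 = 0) → ∀ j, c j = 0 := by
  have hκpos : ∀ j, 0 < κ j := fun j => hκ j ▸ mul_pos hm (Real.sin_pos_of_mem_Ioo (hθ j))
  have hs' : ∀ j, s j = Complex.exp ((θ j : ℂ) * Complex.I) := fun j => by rw [hs, mul_comm]
  have hs0 : ∀ j, s j ≠ 0 := fun j => hs j ▸ Complex.exp_ne_zero _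
  have hconj : ∀ j, conj (s j) = (s j)⁻¹ := fun j => by
    rw [Complex.inv_def, Complex.normSq_eq_norm_sq, hs' j, Complex.norm_exp_ofReal_mul_I]
    simp
  have hsim : ∀ j, 0 < (s j).im := fun j => by
    rw [hs' j, Complex.exp_ofReal_mul_I_im]
    exact Real.sin_pos_of_mem_Ioo (hθ j)
  have hst : ∀ k j, s k - (s j)⁻¹ ≠ 0 := fun k j h => by
    have him := congrArg Complex.im h
    rw [← hconj, Complex.sub_im, Complex.conj_im, Complex.zero_im] at him
    linarith [hsim k, hsim j]
  have hsinj : Function.Injective s := fun j l h => by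
    have hre := congrArg Complex.re h
    rw [hs', hs', Complex.exp_ofReal_mul_I_re, Complex.exp_ofReal_mul_I_re] at hre
    exact hθinj (Real.injOn_cos (Set.Ioo_subset_Icc_self (hθ j))
      (Set.Ioo_subset_Icc_self (hθ l)) hre)
  set P : Fin n → ℝ := fun j => κ j * Real.exp (-(2 * κ j * xc j)) with hP
  have hPpos : ∀ j, 0 < P j := fun j => mul_pos (hκpos j) (Real.exp_pos _)
  have he2 : ∀ j x, e j x ^ 2 = P j * Real.exp (2 * κ j * x) := fun j x => by
    rw [he, mul_pow, Real.sq_sqrt (hκpos j).le, ← Real.exp_nat_mul, hP, mul_assoc, ← Real.exp_add]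
    congr 2
    push_cast
    ring
  clear_value P
  have he0 : ∀ j x, (e j x : ℂ) ≠ 0 := fun j x => by
    rw [he]
    exact_mod_cast (mul_pos (Real.sqrt_pos.mpr (hκpos j)) (Real.exp_pos _)).ne'
  set C : Matrix (Fin n) (Fin n) ℂ :=
    Matrix.of fun j l => (2 * Complex.I / (m : ℂ)) / (s l - (s j)⁻¹) with hC
  have hGC : ∀ x j l, G x j l = C j l * (e j x : ℂ) * (e l x : ℂ) := fun x j l => by
    rw [hG, hC, Matrix.of_apply, ← neg_sub (s l), div_neg]
    ring
  have hf' : ∀ x j, f x j + ∑ l, C j l * (e j x : ℂ) * (e l x : ℂ) * f x l = -(e j x : ℂ) :=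
    fun x j => by
      have := congrFun (hf x) j
      rw [Matrix.add_mulVec, Matrix.one_mulVec, Pi.add_apply] at this
      rw [← this]
      simp only [Matrix.mulVec, dotProduct, hGC]
  have hCdet : C.det ≠ 0 := by
    intro h
    obtain ⟨v, hv0, hv⟩ := Matrix.exists_mulVec_eq_zero_iff.mpr h
    have ha : 2 * Complex.I / (m : ℂ) ≠ 0 := by simp [hm.ne']
    have hv' := eq_zero_of_cauchy_sum_eq_zero (t := fun j => (s j)⁻¹)
      (v := fun l => (2 * Complex.I / (m : ℂ)) * v l) hsinj (inv_injective.comp hsinj) hst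
      fun j => by
        rw [← show (C *ᵥ v) j = 0 from congrFun hv j]
        simp only [Matrix.mulVec, dotProduct, hC, Matrix.of_apply]
        exact Finset.sum_congr rfl fun k _ => by ring
    exact hv0 (funext fun l => (mul_eq_zero.mp (congrFun hv' l)).resolve_left ha)
  -- The limits of `f j / e j` at `-∞` and of `f j * e j` at `+∞`.
  have hexp : ∀ j, Tendsto (fun x : ℝ => Real.exp (2 * κ j * x)) atBot (𝓝 0) := fun j =>
    Real.tendsto_exp_atBot.comp
      (tendsto_id.const_mul_atBot (mul_pos two_pos (hκpos j)))
  have hbot : Tendsto (fun x j => f x j / (e j x : ℂ)) atBot (𝓝 fun _ => -1) := by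
    have hd : Tendsto (fun x l => ((e l x ^ 2 : ℝ) : ℂ)) atBot (𝓝 (0 : Fin n → ℂ)) := by
      refine tendsto_pi_nhds.mpr fun l => ?_
      have h := (Complex.continuous_ofReal.tendsto _).comp ((hexp l).const_mul (P l))
      simpa [Function.comp_def, he2] using h
    have hcont : Continuous fun d : Fin n → ℂ => 1 + C * Matrix.diagonal d :=
      continuous_const.add (continuous_const.matrix_mul continuous_id.matrix_diagonal)
    have hM := (hcont.tendsto 0).comp hd
    rw [Matrix.diagonal_zero', mul_zero, add_zero] at hM
    have := tendsto_of_mulVec_eq (u := fun x j => f x j / (e j x : ℂ)) (w := fun _ => -1) hM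
      (by simp) fun x => funext fun j => by
        simp only [Function.comp_apply, Matrix.add_mulVec, Matrix.one_mulVec, Pi.add_apply]
        simp only [Matrix.mulVec, dotProduct, Matrix.mul_diagonal]
        have h := hf' x j
        have h0 := he0 j x
        rw [← mul_right_inj' h0, mul_add, mul_div_cancel₀ _ h0, Finset.mul_sum, mul_neg_one, ← h]
        congr 1
        refine Finset.sum_congr rfl fun l _ => ?_
        have h1 := he0 l x
        push_cast
        field_simp
    simpa using this
  obtain ⟨b, hb, htop⟩ : ∃ b : Fin n → ℂ, C *ᵥ b = (fun _ => 1) ∧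
      Tendsto (fun x j => -((e j x : ℂ) * f x j)) atTop (𝓝 b) := by
    refine ⟨C⁻¹ *ᵥ fun _ => 1, ?_, ?_⟩
    · rw [Matrix.mulVec_mulVec, Matrix.mul_nonsing_inv _ (isUnit_iff_ne_zero.mpr hCdet),
        Matrix.one_mulVec]
    have hd : Tendsto (fun x l => (((e l x ^ 2)⁻¹ : ℝ) : ℂ)) atTop (𝓝 (0 : Fin n → ℂ)) := by
      refine tendsto_pi_nhds.mpr fun l => ?_
      have h := (Complex.continuous_ofReal.tendsto _).comp
        (((hexp l).comp tendsto_neg_atTop_atBot).const_mul (P l)⁻¹)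
      simpa [Function.comp_def, he2, Real.exp_neg, mul_comm] using h
    have hcont : Continuous fun d : Fin n → ℂ => Matrix.diagonal d + C :=
      continuous_id.matrix_diagonal.add continuous_const
    have hM := (hcont.tendsto 0).comp hd
    rw [Matrix.diagonal_zero', zero_add] at hM
    refine tendsto_of_mulVec_eq hM hCdet fun x => funext fun j => ?_
    simp only [Function.comp_apply, Matrix.add_mulVec, Pi.add_apply, Matrix.mulVec_diagonal]
    simp only [Matrix.mulVec, dotProduct]
    have h := hf' x j
    have h0 := he0 j x
    have h2 : (e j x : ℂ) * ∑ l, C j l * -((e l x : ℂ) * f x l)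
        = -∑ l, C j l * (e j x : ℂ) * (e l x : ℂ) * f x l := by
      rw [Finset.mul_sum, ← Finset.sum_neg_distrib]
      exact Finset.sum_congr rfl fun l _ => by ring
    have h3 : (e j x : ℂ) * ((((e j x ^ 2)⁻¹ : ℝ) : ℂ) * -((e j x : ℂ) * f x j)) = -f x j := by
      push_cast
      field_simp
    rw [← mul_right_inj' h0, mul_add, h2, h3]
    linear_combination -h
  have hb' : ∀ j, ∑ k, (2 * Complex.I / (m : ℂ)) * b k / (s k - (s j)⁻¹) = 1 := fun j => by
    rw [← congrFun hb j]
    simp only [Matrix.mulVec, dotProduct, hC, Matrix.of_apply]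
    exact Finset.sum_congr rfl fun k _ => by ring
  have hb0 : ∀ j, b j ≠ 0 := fun j h =>
    ne_zero_of_cauchy_sum_eq_const (t := fun j => (s j)⁻¹) hsinj (inv_injective.comp hsinj) hst
      one_ne_zero hb' j (by rw [h, mul_zero])
  obtain ⟨μ, hμ⟩ := exists_eq_mul_sq_mul_conj hm.ne' hsinj hconj hs0 hst hb'
  intro c hc
  by_contra! hex
  obtain ⟨i, hi, hmin⟩ := (Finset.univ.filter fun j => c j ≠ 0).exists_min_image κ
    (by simpa [Finset.Nonempty] using hex)
  have hci : c i ≠ 0 := (Finset.mem_filter.mp hi).2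
  have hk : ∀ j, c j ≠ 0 → 0 ≤ κ j - κ i := fun j hj =>
    sub_nonneg.mpr (hmin j (Finset.mem_filter.mpr ⟨Finset.mem_univ j, hj⟩))
  have hμ0 : μ ≠ 0 := fun h => hb0 i (by rw [hμ i, h]; ring)
  have hiff : ∀ j, κ j - κ i = 0 ↔ Real.sin (θ j) = Real.sin (θ i) := fun j => by
    rw [sub_eq_zero, hκ, hκ, mul_right_inj' hm.ne']
  have hlim₁ : ∑ j, (if κ j - κ i = 0 then c j * (P j : ℂ) else 0) = 0 := by
    have hlim := tendsto_finsetSum Finset.univ fun j _ => tendsto_mul_exp_atBot (hk j)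
      (((tendsto_pi_nhds.mp hbot j).pow 2).const_mul (P j : ℂ))
    simp only [neg_one_sq, mul_one] at hlim
    refine tendsto_nhds_unique hlim (tendsto_const_nhds.congr fun x => ?_)
    rw [← mul_zero ((Real.exp (-(2 * κ i * x)) : ℝ) : ℂ), ← hc x, Finset.mul_sum]
    refine Finset.sum_congr rfl fun j _ => ?_
    have h0 := he0 j x
    have h1 : (e j x : ℂ) ^ 2 = P j * (Real.exp (2 * κ j * x) : ℝ) := by exact_mod_cast he2 j x
    have h2 : Real.exp (2 * (κ j - κ i) * x)
        = Real.exp (2 * κ j * x) * Real.exp (-(2 * κ i * x)) := by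
      rw [← Real.exp_add]; ring_nf
    have h3 : (P j : ℂ) * (Real.exp (2 * κ j * x) : ℝ) ≠ 0 := h1 ▸ pow_ne_zero 2 h0
    have h4 : (P j : ℂ) * (f x j / (e j x : ℂ)) ^ 2 * (Real.exp (2 * κ j * x) : ℝ)
        = f x j ^ 2 := by
      rw [div_pow, h1, mul_right_comm, mul_div_cancel₀ _ h3]
    rw [h2, Complex.ofReal_mul, ← h4]
    ring
  have hlim₂ : ∑ j, (if κ j - κ i = 0 then c j * ((P j : ℂ)⁻¹ * b j ^ 2) else 0) = 0 := by
    have hlim := tendsto_finsetSum Finset.univ fun j _ => tendsto_mul_exp_atBot (hk j)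
      ((((tendsto_pi_nhds.mp htop j).comp tendsto_neg_atBot_atTop).pow 2).const_mul (P j : ℂ)⁻¹)
    refine tendsto_nhds_unique hlim (tendsto_const_nhds.congr fun x => ?_)
    rw [← mul_zero ((Real.exp (-(2 * κ i * x)) : ℝ) : ℂ), ← hc (-x), Finset.mul_sum]
    refine Finset.sum_congr rfl fun j _ => ?_
    have h1 : (e j (-x) : ℂ) ^ 2 = P j * (Real.exp (2 * κ j * (-x)) : ℝ) := by
      exact_mod_cast he2 j (-x)
    have h2 : Real.exp (-(2 * κ i * x))
        = Real.exp (2 * (κ j - κ i) * x) * Real.exp (2 * κ j * (-x)) := by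
      rw [← Real.exp_add]; ring_nf
    have h3 : (P j : ℂ) ≠ 0 := by exact_mod_cast (hPpos j).ne'
    rw [Function.comp_apply, neg_sq, mul_pow, h1, h2, Complex.ofReal_mul]
    field_simp
  simp only [hiff] at hlim₁ hlim₂
  refine hci (eq_zero_of_phase_relations (P := P) (Q := fun j => (P j)⁻¹ * ‖b j‖ ^ 2) hθ hθinj
    hPpos (fun j => mul_pos (inv_pos.mpr (hPpos j)) (pow_pos (norm_pos_iff.mpr (hb0 j)) 2)) i
    hlim₁ ?_)
  refine (mul_eq_zero.mp ?_).resolve_left hμ0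
  refine Eq.trans ?_ hlim₂
  rw [Finset.mul_sum]
  refine Finset.sum_congr rfl fun j _ => ?_
  split_ifs
  · rw [← hs j]
    push_cast
    rw [← Complex.mul_conj' (b j)]
    linear_combination (-c j * (P j : ℂ)⁻¹ * b j) * hμ j
  · exact mul_zero _
end

section
/- (Reduction to real condensates, even case) In the n-soliton setup with n = 2n' even, suppose that for each j = 1, …, n' one has θ_{2j−1} = π − θ_{2j} (equivalently s_{2j−1} = −conj(s_{2j})) and x_{2j−1} = x_{2j} (with all θ₁, …, θₙ still pairwise distinct, so in particular θ_{2j} ≠ π/2). Then f_{2j−1}(x) = conj(f_{2j}(x)) for all x ∈ ℝ and all j = 1, …, n', and consequently Δ(x) is real for every x ∈ ℝ. -/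
open Matrix

open ComplexConjugate in
/-- If an involution `σ` of the index set intertwines a complex matrix with its entrywise conjugate
and preserves a real right-hand side, then it intertwines the solution with its conjugate. -/
theorem conj_comp_involutive_of_mulVec_eq {ι : Type*} [Fintype ι] [DecidableEq ι]
    {σ : ι → ι} (hσ : Function.Involutive σ) {A : Matrix ι ι ℂ} (hA : IsUnit A)
    (hAσ : ∀ j l, A (σ j) (σ l) = conj (A j l)) {v b : ι → ℂ}
    (hbσ : ∀ j, b (σ j) = conj (b j)) (hv : A *ᵥ v = b) (j : ι) :
    v (σ j) = conj (v j) := by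
  have hw : A *ᵥ (fun l => conj (v (σ l))) = b := by
    funext k
    have h := congrFun hv (σ k)
    rw [hbσ, Matrix.mulVec, dotProduct, ← hσ.bijective.sum_comp] at h
    rw [← Complex.conj_conj (b k), ← h, Matrix.mulVec, dotProduct, map_sum]
    exact Finset.sum_congr rfl fun l _ => by rw [hAσ, map_mul, Complex.conj_conj]
  have h := congrFun (Matrix.mulVec_injective_of_isUnit hA (hw.trans hv.symm)) j
  rw [← h, Complex.conj_conj]

open ComplexConjugate in
theorem exp_I_mul_pi_sub (t : ℝ) :
    Complex.exp (Complex.I * ((Real.pi - t : ℝ) : ℂ))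
      = -conj (Complex.exp (Complex.I * (t : ℂ))) := by
  rw [← Complex.exp_conj, map_mul, Complex.conj_I, Complex.conj_ofReal, Complex.ofReal_sub,
    mul_sub, sub_eq_add_neg, Complex.exp_add, mul_comm Complex.I (Real.pi : ℂ),
    Complex.exp_pi_mul_I, neg_one_mul, neg_mul]

/-- The involution exchanging `2 * k` and `2 * k + 1`. -/
def pairSwap {n : ℕ} (hn : Even n) (j : Fin n) : Fin n :=
  ⟨if (j : ℕ) % 2 = 0 then j + 1 else j - 1, by
    have := j.isLt
    obtain ⟨k, rfl⟩ := hn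
    split_ifs <;> omega⟩

theorem pairSwap_involutive {n : ℕ} (hn : Even n) : Function.Involutive (pairSwap hn) := by
  intro j
  apply Fin.ext
  simp only [pairSwap]
  split_ifs <;> omega

theorem pairSwap_odd {n : ℕ} (hn : Even n) (k : ℕ) (h₁ : 2 * k + 1 < n) (h₀ : 2 * k < n) :
    pairSwap hn ⟨2 * k + 1, h₁⟩ = ⟨2 * k, h₀⟩ := by
  apply Fin.ext
  simp only [pairSwap]
  split_ifs <;> omega

theorem pairSwap_induction {n : ℕ} (hn : Even n) {P : Fin n → Fin n → Prop}
    (hP : ∀ i j, P i j → P j i)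
    (h : ∀ (k : ℕ) (hk : 2 * k + 1 < n), P ⟨2 * k, by omega⟩ ⟨2 * k + 1, hk⟩) (j : Fin n) :
    P (pairSwap hn j) j := by
  have hodd (k : ℕ) (hk : 2 * k + 1 < n) : P (pairSwap hn ⟨2 * k + 1, hk⟩) ⟨2 * k + 1, hk⟩ := by
    rw [pairSwap_odd hn k hk (by omega)]
    exact h k hk
  obtain ⟨j, hj⟩ := j
  obtain ⟨k, rfl | rfl⟩ := Nat.even_or_odd' j
  · have hk : 2 * k + 1 < n := by
      obtain ⟨r, rfl⟩ := hn
      omega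
    have h' := hP _ _ (hodd k hk)
    rw [← pairSwap_odd hn k hk hj, pairSwap_involutive hn]
    exact h'
  · exact hodd k hj

/-- Reduction to real condensates, even case: in the `n`-soliton setup with `n = 2n'`,
if `θ_{2j−1} = π − θ_{2j}` and `x_{2j−1} = x_{2j}` for each pair, then
`f_{2j−1} = conj f_{2j}` and `Δ(x)` is real for every `x`. -/
theorem nsoliton_real_reduction_even
    (m : ℝ) (hm : 0 < m) (n : ℕ) (hn : 1 ≤ n)
    (θ xc : Fin n → ℝ) (hθ : ∀ j, θ j ∈ Set.Ioo 0 Real.pi)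
    (hθinj : Function.Injective θ)
    (s : Fin n → ℂ) (hs : ∀ j, s j = Complex.exp (Complex.I * (θ j : ℂ)))
    (κ : Fin n → ℝ) (hκ : ∀ j, κ j = m * Real.sin (θ j))
    (e : Fin n → ℝ → ℝ)
    (he : ∀ j x, e j x = Real.sqrt (κ j) * Real.exp (κ j * (x - xc j)))
    (G : ℝ → Matrix (Fin n) (Fin n) ℂ)
    (hG : ∀ x j l, G x j l
      = -(2 * Complex.I / (m : ℂ)) * (e j x : ℂ) * (e l x : ℂ) / ((s j)⁻¹ - s l))
    (hinv : ∀ x : ℝ, IsUnit (1 + G x))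
    (f : ℝ → Fin n → ℂ)
    (hf : ∀ x : ℝ, (1 + G x) *ᵥ (f x) = fun j => -((e j x : ℂ)))
    (hfd : ∀ j, Differentiable ℝ (fun x => f x j))
    (Δ : ℝ → ℂ)
    (hΔ : ∀ x : ℝ, Δ x = (m : ℂ) + 2 * Complex.I * ∑ j, (s j)⁻¹ * (e j x : ℂ) * f x j)
    (n' : ℕ) (hn2 : n = 2 * n')
    (hpairθ : ∀ j : Fin n',
      θ ⟨2 * (j : ℕ), by have := j.isLt; omega⟩
        = Real.pi - θ ⟨2 * (j : ℕ) + 1, by have := j.isLt; omega⟩)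
    (hpairx : ∀ j : Fin n',
      xc ⟨2 * (j : ℕ), by have := j.isLt; omega⟩
        = xc ⟨2 * (j : ℕ) + 1, by have := j.isLt; omega⟩) :
    (∀ j : Fin n', ∀ x : ℝ,
      f x ⟨2 * (j : ℕ), by have := j.isLt; omega⟩
        = (starRingEnd ℂ) (f x ⟨2 * (j : ℕ) + 1, by have := j.isLt; omega⟩)) ∧
    (∀ x : ℝ, (Δ x).im = 0) := by
  have hne : Even n := ⟨n', by omega⟩
  have hσ := pairSwap_involutive hne
  have hθσ : ∀ j, θ (pairSwap hne j) = Real.pi - θ j :=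
    pairSwap_induction hne (P := fun i j => θ i = Real.pi - θ j)
      (fun i j h => by linarith) (fun k hk => hpairθ ⟨k, by omega⟩)
  have hxσ : ∀ j, xc (pairSwap hne j) = xc j :=
    pairSwap_induction hne (P := fun i j => xc i = xc j)
      (fun i j h => h.symm) (fun k hk => hpairx ⟨k, by omega⟩)
  have hsσ (j) : s (pairSwap hne j) = -(starRingEnd ℂ) (s j) := by
    rw [hs, hs, hθσ, exp_I_mul_pi_sub]
  have heσ (j x) : e (pairSwap hne j) x = e j x := by
    simp only [he, hκ, hθσ, hxσ, Real.sin_pi_sub]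
  have hGσ (x j l) : G x (pairSwap hne j) (pairSwap hne l) = (starRingEnd ℂ) (G x j l) := by
    simp only [hG, heσ, hsσ, map_mul, map_div₀, map_sub, map_inv₀, map_neg, Complex.conj_I,
      Complex.conj_ofReal, map_ofNat, inv_neg]
    rw [← neg_sub', div_neg]
    ring
  have hfσ (x j) : f x (pairSwap hne j) = (starRingEnd ℂ) (f x j) := by
    refine conj_comp_involutive_of_mulVec_eq hσ (hinv x) (fun j l => ?_) (fun j => ?_) (hf x) j
    · simp only [Matrix.add_apply, hGσ, map_add, Matrix.one_apply, hσ.injective.eq_iff, apply_ite,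
        map_one, map_zero]
    · simp only [heσ, map_neg, Complex.conj_ofReal]
  refine ⟨fun j x => ?_, fun x => ?_⟩
  · rw [← hfσ, pairSwap_odd]
  · rw [← Complex.conj_eq_iff_im, hΔ, map_add, map_mul, map_mul, map_sum, Complex.conj_ofReal,
      Complex.conj_I, map_ofNat, ← hσ.bijective.sum_comp (fun j => (s j)⁻¹ * (e j x : ℂ) * f x j)]
    simp only [hsσ, heσ, hfσ, map_mul, map_inv₀, Complex.conj_ofReal, inv_neg, neg_mul,
      Finset.sum_neg_distrib, mul_neg]
end
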